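/- Fix integers j ≥ 0 and k ≥ 1. Then there exists N such that for all n ≥ N: (𝒫_{n,k}^{n−j}/C(n−3,k))² ≥ (𝒫_{n,k−1}^{n−j}/C(n−3,k−1))·(𝒫_{n,k+1}^{n−j}/C(n−3,k+1)) and (𝒬_{n,k}^{n−j}/C(n−2,k))² ≥ (𝒬_{n,k−1}^{n−j}/C(n−2,k−1))·(𝒬_{n,k+1}^{n−j}/C(n−2,k+1)), where C(a,b) denotes the binomial coefficient. -/

import Mathlib

open Polynomial

/-- The ring `ℚ[m][t]`: polynomials in `t` with coefficients in `ℚ[m]`. -/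
abbrev Qmt : Type := Polynomial (Polynomial ℚ)

/-- The element `m` of `ℚ[m][t]`. -/
noncomputable def mPoly : Qmt := Polynomial.C Polynomial.X

/-- `f^{[d]}`: substitute `t ↦ t^d`, leaving `m` unchanged. -/
noncomputable def tPow (d : ℕ) (f : Qmt) : Qmt := f.comp (Polynomial.X ^ d)

/-- `f^{[μ]} = f^{[μ₁]} ⋯ f^{[μ_ℓ]}` for a multiset `μ` of positive integers. -/
noncomputable def tPowMul (μ : Multiset ℕ) (f : Qmt) : Qmt := (μ.map (fun d => tPow d f)).prod

/-- `z_μ = ∏ i, i ^ (mult of i) * (mult of i)!`. -/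
def zPart (μ : Multiset ℕ) : ℕ := ∏ i ∈ μ.toFinset, i ^ μ.count i * (μ.count i).factorial

/-- The plethysm `h_r ∘ f = Σ_{μ ⊢ r} z_μ⁻¹ f^{[μ]}`. -/
noncomputable def plethH (r : ℕ) (f : Qmt) : Qmt :=
  ∑ μ : Nat.Partition r, Polynomial.C (Polynomial.C ((zPart μ.parts : ℚ)⁻¹)) * tPowMul μ.parts f

/-- The polynomials `𝒬ₙ⁺ ∈ ℚ[m][t]`: `𝒬₁⁺ = m` and, for `n ≥ 2`,
`𝒬ₙ⁺ = Σ_{λ ⊢ n} (Σ_{i=1}^{ℓ(λ)-2} t^i) ∏_j (h_{r_j} ∘ 𝒬⁺_{n_j})` where `n_j` are the distinct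
parts of `λ` with multiplicities `r_j`.  (The recursion is well-founded: the term of `λ = (n)`
has coefficient `Σ_{i=1}^{1-2} t^i = 0`, so the guard `p < n` does not change any value.) -/
noncomputable def Qplus : ℕ → Qmt := fun n =>
  Nat.strongRecOn n fun n ih =>
    if n = 1 then mPoly
    else
      ∑ lam : Nat.Partition n,
        (∑ i ∈ Finset.Icc 1 (Multiset.card lam.parts - 2), (Polynomial.X : Qmt) ^ i) *
          ∏ p ∈ lam.parts.toFinset,
            plethH (lam.parts.count p) (if h : p < n then ih p h else 0)

/-- The polynomials `𝒬ₙ ∈ ℚ[m][t]`: `𝒬₁ = m` and, for `n ≥ 2`,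
`𝒬ₙ = Σ_{λ ⊢ n} ∏_j (h_{r_j} ∘ 𝒬⁺_{n_j})`. -/
noncomputable def Qfull (n : ℕ) : Qmt :=
  if n = 1 then mPoly
  else ∑ lam : Nat.Partition n, ∏ p ∈ lam.parts.toFinset, plethH (lam.parts.count p) (Qplus p)

/-- `𝒬_{n,k}(m)`: the coefficient of `t^k` in `𝒬ₙ`, a polynomial in `m`. -/
noncomputable def Qnk (n k : ℕ) : Polynomial ℚ := (Qfull n).coeff k

/-- The right-hand side `𝒬ₙ − (t/2)(Σ_{h=2}^{n-2} 𝒬_h 𝒬_{n-h} − 𝒬_{n/2}^{[2]})` of the relation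
defining `𝒫ₙ`, where `𝒬_{n/2} = 0` when `n` is odd. -/
noncomputable def Prhs (n : ℕ) : Qmt :=
  Qfull n -
    Polynomial.C (Polynomial.C ((2 : ℚ)⁻¹)) * Polynomial.X *
      ((∑ h ∈ Finset.Icc 2 (n - 2), Qfull h * Qfull (n - h)) -
        (if 2 ∣ n then tPow 2 (Qfull (n / 2)) else 0))

/-- `c_k = (k+1)^{k-1}/k!`. -/
noncomputable def ck (k : ℕ) : ℚ := ((k : ℚ) + 1) ^ ((k : ℤ) - 1) / (k.factorial : ℚ)

/-- `d_k = (k+1)^{k-2}/k!`. -/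
noncomputable def dk (k : ℕ) : ℚ := ((k : ℚ) + 1) ^ ((k : ℤ) - 2) / (k.factorial : ℚ)

open PowerSeries in
/-- The operator `D + c · (X d/dX)` on power series, with `D` acting on coefficients. -/
noncomputable def weightedDeriv {R : Type*} [CommRing R] [Algebra ℚ R] (D : Derivation ℚ R R)
    (c : R) (f : PowerSeries R) : PowerSeries R :=
  PowerSeries.mk fun n => D (PowerSeries.coeff n f) + c * n * PowerSeries.coeff n f

section LogDerivative

open PowerSeries

open Nat.Partition in
lemma exists_prod_expand_coeff_eq_genFun {R : Type*} [CommRing R] (f : ℕ → ℕ → R)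
    (hf : ∀ i, f i 0 = 1) (n : ℕ) :
    ∃ s : Finset ℕ, Finset.range n ⊆ s ∧ ∀ m ≤ n,
      PowerSeries.coeff m (∏ i ∈ s, PowerSeries.expand (i + 1) i.succ_ne_zero (mk (f (i + 1)))) =
        PowerSeries.coeff m (genFun f) := by
  let _ : TopologicalSpace R := ⊥
  have _ : DiscreteTopology R := ⟨rfl⟩
  open scoped PowerSeries.WithPiTopology in
  have key : ∀ i : ℕ, (1 + ∑' j, f (i + 1) (j + 1) • (PowerSeries.X : R⟦X⟧) ^ ((i + 1) * (j + 1))) =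
      PowerSeries.expand (i + 1) i.succ_ne_zero (mk (f (i + 1))) := by
    intro i
    ext m
    rw [map_add, (summable_genFun_term f i).map_tsum _ (WithPiTopology.continuous_coeff _ _),
      PowerSeries.coeff_expand, coeff_mk]
    simp only [map_smul, PowerSeries.coeff_X_pow, smul_eq_mul, mul_ite, mul_one, mul_zero]
    split_ifs with h
    · obtain ⟨q, rfl⟩ := h
      rw [Nat.mul_div_cancel_left _ i.succ_pos]
      cases q with
      | zero =>
        simp [hf]
      | succ q =>
        rw [tsum_eq_single q]
        · simp [PowerSeries.coeff_one]
        · intro b hb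
          rw [if_neg]
          intro h
          exact hb (by simpa using (Nat.eq_of_mul_eq_mul_left i.succ_pos h).symm)
    · have h0 : m ≠ 0 := by rintro rfl; exact h (dvd_zero _)
      have : ∀ j, ¬ m = (i + 1) * (j + 1) := fun j hj => h ⟨_, hj⟩
      simp [this, PowerSeries.coeff_one, h0]
  open scoped PowerSeries.WithPiTopology in
  have hp := hasProd_genFun f
  simp_rw [key] at hp
  rw [HasProd, WithPiTopology.tendsto_iff_coeff_tendsto] at hp
  have h2 : ∀ m ∈ Finset.range (n + 1), ∀ᶠ s in Filter.atTop,
      PowerSeries.coeff m (∏ i ∈ s, PowerSeries.expand (i + 1) i.succ_ne_zero (mk (f (i + 1)))) =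
        PowerSeries.coeff m (genFun f) := by
    intro m _
    have := hp m
    rw [nhds_discrete, Filter.tendsto_pure] at this
    exact this
  have h3 := (Filter.eventually_all_finset _).mpr h2
  obtain ⟨s, hs1, hs2⟩ := (h3.and (Filter.eventually_ge_atTop (Finset.range n))).exists
  exact ⟨s, hs2, fun m hm => hs1 m (by simpa [Nat.lt_succ_iff] using hm)⟩

variable {R : Type*} [CommRing R] [Algebra ℚ R] (D : Derivation ℚ R R)

lemma coeff_weightedDeriv (c : R) (f : R⟦X⟧) (n : ℕ) :
    PowerSeries.coeff n (weightedDeriv D c f) = D (PowerSeries.coeff n f) + c * n *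
      PowerSeries.coeff n f := by
  simp [weightedDeriv]

lemma weightedDeriv_mul (c : R) (f g : R⟦X⟧) :
    weightedDeriv D c (f * g) = f * weightedDeriv D c g + weightedDeriv D c f * g := by
  ext n
  simp only [coeff_weightedDeriv, map_add, PowerSeries.coeff_mul, map_sum, Finset.mul_sum,
    ← Finset.sum_add_distrib]
  refine Finset.sum_congr rfl fun p hp => ?_
  rw [← Finset.HasAntidiagonal.mem_antidiagonal.mp hp, Derivation.leibniz]
  push_cast
  simp only [smul_eq_mul]
  ring

lemma weightedDeriv_one (c : R) : weightedDeriv D c (1 : R⟦X⟧) = 0 := by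
  ext n
  rw [coeff_weightedDeriv, PowerSeries.coeff_one]
  split_ifs with h <;> simp [h]

lemma weightedDeriv_expand (c : R) (i : ℕ) (hi : i ≠ 0) (f : R⟦X⟧) :
    weightedDeriv D c (PowerSeries.expand i hi f) = PowerSeries.expand i hi
      (weightedDeriv D (c * i) f) := by
  ext n
  rw [coeff_weightedDeriv, PowerSeries.coeff_expand, PowerSeries.coeff_expand]
  split_ifs with h
  · obtain ⟨q, rfl⟩ := h
    rw [Nat.mul_div_cancel_left _ (Nat.pos_of_ne_zero hi), coeff_weightedDeriv]
    push_cast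
    ring
  · simp

lemma weightedDeriv_prod (c : R) (s : Finset ℕ) (G L : ℕ → R⟦X⟧)
    (h : ∀ i ∈ s, weightedDeriv D c (G i) = G i * L i) :
    weightedDeriv D c (∏ i ∈ s, G i) = (∏ i ∈ s, G i) * ∑ i ∈ s, L i := by
  classical
  induction s using Finset.induction_on with
  | empty => simp [weightedDeriv_one]
  | insert a s ha ih =>
    rw [Finset.prod_insert ha, Finset.sum_insert ha, weightedDeriv_mul,
      ih fun i hi => h i (Finset.mem_insert_of_mem hi), h a (Finset.mem_insert_self a s)]
    ring

lemma weightedDeriv_exp (c a : R) :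
    weightedDeriv D c (mk fun n => ((n.factorial : ℚ)⁻¹) • a ^ n) =
      (mk fun n => ((n.factorial : ℚ)⁻¹) • a ^ n) *
        (PowerSeries.C (D a + c * a) * PowerSeries.X) := by
  ext n
  rw [coeff_weightedDeriv, ← mul_assoc]
  cases n with
  | zero => simp
  | succ n =>
    rw [PowerSeries.coeff_succ_mul_X, PowerSeries.coeff_mul_C, coeff_mk, coeff_mk,
      Derivation.map_smul,
      Derivation.leibniz_pow, Nat.factorial_succ, nsmul_eq_mul, smul_eq_mul]
    have h : (((n + 1) * n.factorial : ℕ) : ℚ)⁻¹ * ((n : ℚ) + 1) = ((n.factorial : ℚ)⁻¹) := by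
      push_cast
      field_simp
    rw [← h, mul_smul]
    simp only [Algebra.smul_def, map_add, map_one, map_natCast, Nat.add_sub_cancel]
    push_cast
    ring

open Nat.Partition in
lemma weightedDeriv_genFun (c : R) (f : ℕ → ℕ → R) (hf : ∀ i, f i 0 = 1) (l : ℕ → R⟦X⟧)
    (hl : ∀ i : ℕ, weightedDeriv D (c * i) (mk (f i)) = mk (f i) * l i)
    (hl0 : ∀ i : ℕ, PowerSeries.coeff 0 (l i) = 0) :
    weightedDeriv D c (genFun f) =
      genFun f * mk fun b => ∑ i ∈ b.divisors, PowerSeries.coeff (b / i) (l i) := by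
  ext n
  obtain ⟨s, hs, h⟩ := exists_prod_expand_coeff_eq_genFun f hf n
  rw [coeff_weightedDeriv, ← h n le_rfl, ← coeff_weightedDeriv,
    weightedDeriv_prod D c s _ (fun i => PowerSeries.expand (i + 1) i.succ_ne_zero (l (i + 1))),
      PowerSeries.coeff_mul,
    PowerSeries.coeff_mul]
  · refine Finset.sum_congr rfl fun p hp => ?_
    have hp' := Finset.HasAntidiagonal.mem_antidiagonal.mp hp
    rw [h _ (by omega), coeff_mk, map_sum]
    congr 1
    have h1 : ∀ i ∈ s, PowerSeries.coeff p.2 (PowerSeries.expand (i + 1) i.succ_ne_zero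
        (l (i + 1))) =
        if (i + 1) ∣ p.2 ∧ p.2 ≠ 0 then PowerSeries.coeff (p.2 / (i + 1)) (l (i + 1)) else 0 := by
      intro i _
      rw [PowerSeries.coeff_expand]
      by_cases h0 : p.2 = 0
      · simp [h0, hl0]
      · simp [h0]
    rw [Finset.sum_congr rfl h1, ← Finset.sum_filter]
    refine Finset.sum_bij (fun i _ => i + 1) ?_ ?_ ?_ ?_
    · intro i hi
      simpa using (Finset.mem_filter.mp hi).2
    · intro a _ b _ hab
      simpa using hab
    · intro b hb
      have hb1 := Nat.mem_divisors.mp hb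
      have hb2 := Nat.pos_of_mem_divisors hb
      have hb3 := Nat.le_of_dvd (Nat.pos_of_ne_zero hb1.2) hb1.1
      refine ⟨b - 1, Finset.mem_filter.mpr ⟨hs (Finset.mem_range.mpr (by omega)), ?_⟩, by omega⟩
      rw [Nat.sub_add_cancel hb2]
      exact hb1
    · intro i _
      rfl
  · intro i _
    rw [weightedDeriv_expand, Nat.cast_add_one, ← map_mul, ← hl (i + 1)]
    push_cast
    rfl

end LogDerivative

/-- The generating series `Σ_n (Σ_{λ ⊢ n} ∏_j h_{r_j} ∘ g_{n_j}) X^n` of the plethysms of a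
sequence `g`. -/
noncomputable def plethSeries (g : ℕ → Qmt) : PowerSeries Qmt :=
  Nat.Partition.genFun fun p c => plethH c (g p)

/-- The coefficients of the logarithm of `plethSeries g`. -/
noncomputable def logPleth (g : ℕ → Qmt) (b : ℕ) : Qmt :=
  ∑ p ∈ b.divisors, (((b / p : ℕ) : ℚ)⁻¹) • tPow (b / p) (g p)

section Plethysm

open PowerSeries

lemma plethH_eq_coeff_genFun (r : ℕ) (f : Qmt) :
    plethH r f = PowerSeries.coeff r (Nat.Partition.genFun fun i c =>
      ((c.factorial : ℚ)⁻¹) • (((i : ℚ)⁻¹) • tPow i f) ^ c) := by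
  rw [Nat.Partition.coeff_genFun, plethH]
  refine Finset.sum_congr rfl fun μ _ => ?_
  rw [Finsupp.prod, Multiset.toFinsupp_support, tPowMul, Finset.prod_multiset_map_count, zPart]
  have h : ∀ (a : ℚ) (x : Qmt), Polynomial.C (Polynomial.C a) * x = a • x := by
    intro a x
    rw [Algebra.smul_def]
    rfl
  rw [h, Nat.cast_prod, ← Finset.prod_inv_distrib, ← Finset.prod_smul]
  refine Finset.prod_congr rfl fun i _ => ?_
  rw [Multiset.toFinsupp_apply, _root_.smul_pow, smul_smul]
  push_cast
  rw [mul_inv, inv_pow, mul_comm]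

lemma plethH_zero (f : Qmt) : plethH 0 f = 1 := by
  rw [plethH_eq_coeff_genFun, Nat.Partition.coeff_genFun]
  simp

variable (D : Derivation ℚ Qmt Qmt) (c : Qmt)

lemma weightedDeriv_plethH (f : Qmt) :
    weightedDeriv D c (mk fun r => plethH r f) = (mk fun r => plethH r f) * mk fun b =>
      if b = 0 then 0 else
        D (((b : ℚ)⁻¹) • tPow b f) + c * b * (((b : ℚ)⁻¹) • tPow b f) := by
  have h : (mk fun r => plethH r f) = Nat.Partition.genFun fun i c =>
      ((c.factorial : ℚ)⁻¹) • (((i : ℚ)⁻¹) • tPow i f) ^ c := by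
    ext1 r
    rw [coeff_mk, plethH_eq_coeff_genFun]
  rw [h, weightedDeriv_genFun D c _ _ _ (fun i => weightedDeriv_exp D _ _)]
  · congr 1
    ext1 b
    rw [coeff_mk, coeff_mk]
    split_ifs with hb
    · simp [hb]
    · rw [Finset.sum_eq_single b]
      · rw [Nat.div_self (Nat.pos_of_ne_zero hb)]
        simp
      · intro i hi hib
        rw [PowerSeries.coeff_C_mul, PowerSeries.coeff_X, if_neg, mul_zero]
        intro h1
        obtain ⟨q, rfl⟩ := Nat.dvd_of_mem_divisors hi
        rw [Nat.mul_div_cancel_left _ (Nat.pos_of_mem_divisors hi)] at h1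
        simp [h1] at hib
      · intro h
        exact absurd (Nat.mem_divisors_self b hb) h
  · simp
  · simp

lemma weightedDeriv_plethSeries (g : ℕ → Qmt) :
    weightedDeriv D c (plethSeries g) =
      plethSeries g * mk fun b => D (logPleth g b) + c * b * logPleth g b := by
  rw [plethSeries, weightedDeriv_genFun D c _ (fun i => plethH_zero _) _
    (fun i => weightedDeriv_plethH D _ _)]
  · congr 1
    ext1 b
    rw [coeff_mk, coeff_mk, logPleth, map_sum, Finset.mul_sum, ← Finset.sum_add_distrib]
    refine Finset.sum_congr rfl fun i hi => ?_
    have hb := Nat.dvd_of_mem_divisors hi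
    have hi0 := Nat.pos_of_mem_divisors hi
    obtain ⟨q, rfl⟩ := hb
    have hq : q ≠ 0 := by
      rintro rfl
      simp at hi
    rw [Nat.mul_div_cancel_left _ hi0, coeff_mk, if_neg hq]
    push_cast
    ring
  · simp

lemma derivative_coeff_plethSeries (g : ℕ → Qmt) (n : ℕ) :
    Polynomial.derivative (PowerSeries.coeff n (plethSeries g)) =
      ∑ p ∈ Finset.HasAntidiagonal.antidiagonal n,
        PowerSeries.coeff p.1 (plethSeries g) * Polynomial.derivative (logPleth g p.2) := by
  have h := congrArg (PowerSeries.coeff n)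
    (weightedDeriv_plethSeries (Polynomial.derivative'.restrictScalars ℚ) 0 g)
  simpa [coeff_weightedDeriv, PowerSeries.coeff_mul] using h

lemma natCast_mul_coeff_plethSeries (g : ℕ → Qmt) (n : ℕ) :
    (n : Qmt) * PowerSeries.coeff n (plethSeries g) =
      ∑ p ∈ Finset.HasAntidiagonal.antidiagonal n,
        PowerSeries.coeff p.1 (plethSeries g) * (p.2 * logPleth g p.2) := by
  have h := congrArg (PowerSeries.coeff n) (weightedDeriv_plethSeries 0 1 g)
  simpa [coeff_weightedDeriv, PowerSeries.coeff_mul] using h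

lemma Qplus_eq (n : ℕ) : Qplus n = if n = 1 then mPoly else
      ∑ lam : Nat.Partition n,
        (∑ i ∈ Finset.Icc 1 (Multiset.card lam.parts - 2), (Polynomial.X : Qmt) ^ i) *
          ∏ p ∈ lam.parts.toFinset,
            plethH (lam.parts.count p) (if p < n then Qplus p else 0) := by
  rw [Qplus, Nat.strongRecOn_eq]
  rfl

lemma plethH_one (f : Qmt) : plethH 1 f = f := by
  rw [plethH_eq_coeff_genFun, Nat.Partition.coeff_genFun]
  simp [Finsupp.prod, tPow]

lemma Qfull_eq (n : ℕ) : Qfull n = PowerSeries.coeff n (plethSeries Qplus) := by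
  rw [Qfull, plethSeries, Nat.Partition.coeff_genFun]
  split_ifs with h
  · subst h
    simp [Finsupp.prod, plethH_one, Qplus_eq 1]
  · simp [Finsupp.prod]

lemma tPow_X_mul (d : ℕ) (f : Qmt) :
    tPow d (Polynomial.X * f) = Polynomial.X ^ d * tPow d f := by
  simp [tPow]

lemma plethH_X_mul (r : ℕ) (f : Qmt) :
    plethH r (Polynomial.X * f) = Polynomial.X ^ r * plethH r f := by
  rw [plethH, plethH, Finset.mul_sum]
  refine Finset.sum_congr rfl fun μ _ => ?_
  have h : ∀ s : Multiset ℕ,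
      tPowMul s (Polynomial.X * f) = Polynomial.X ^ s.sum * tPowMul s f := by
    intro s
    induction s using Multiset.induction_on with
    | empty => simp [tPowMul]
    | cons a s ih =>
      simp only [tPowMul, tPow_X_mul, Multiset.map_cons, Multiset.prod_cons, Multiset.sum_cons,
        pow_add] at ih ⊢
      rw [ih]
      ring
  rw [h, μ.parts_sum]
  ring

lemma coeff_plethSeries_X_mul (g : ℕ → Qmt) (n : ℕ) :
    PowerSeries.coeff n (plethSeries fun p => Polynomial.X * g p) =
      ∑ lam : n.Partition, Polynomial.X ^ (Multiset.card lam.parts) *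
        ∏ p ∈ lam.parts.toFinset, plethH (lam.parts.count p) (g p) := by
  rw [plethSeries, Nat.Partition.coeff_genFun]
  refine Finset.sum_congr rfl fun lam _ => ?_
  simp only [Finsupp.prod, plethH_X_mul, Finset.prod_mul_distrib, Multiset.toFinsupp_support,
    Multiset.toFinsupp_apply, Finset.prod_pow_eq_pow_sum, Multiset.toFinset_sum_count_eq]

lemma X_mul_one_sub_X_mul_sum_Icc (l : ℕ) :
    (Polynomial.X : Qmt) * (1 - Polynomial.X) *
      ∑ i ∈ Finset.Icc 1 l, (Polynomial.X : Qmt) ^ i =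
        Polynomial.X ^ 2 - Polynomial.X ^ (l + 2) := by
  induction l with
  | zero => simp
  | succ l ih =>
    rw [Finset.sum_Icc_succ_top (by omega), mul_add, ih]
    ring

lemma card_parts_eq_one_iff {n : ℕ} (hn : n ≠ 0) (lam : n.Partition) :
    Multiset.card lam.parts = 1 ↔ lam = Nat.Partition.indiscrete n := by
  constructor
  · intro h
    obtain ⟨a, ha⟩ := Multiset.card_eq_one.mp h
    have := lam.parts_sum
    rw [ha, Multiset.sum_singleton] at this
    ext1
    rw [ha, this, Nat.Partition.indiscrete_parts hn]
  · rintro rfl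
    simp [Nat.Partition.indiscrete_parts hn]

/-- The exponential `Exp(t 𝒬⁺)` equals `1 + t m + t² Σ_{n ≥ 2} 𝒬_n`. -/
lemma coeff_plethSeries_X_mul_Qplus (n : ℕ) (hn : 2 ≤ n) :
    PowerSeries.coeff n (plethSeries fun p => Polynomial.X * Qplus p) = Polynomial.X ^ 2 *
      Qfull n := by
  have hn0 : n ≠ 0 := by omega
  have h1 := coeff_plethSeries_X_mul Qplus n
  have h2 := Qplus_eq n
  rw [if_neg (by omega)] at h2
  have h3 : ∀ lam : n.Partition, (Polynomial.X : Qmt) * (1 - Polynomial.X) *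
      ((∑ i ∈ Finset.Icc 1 (Multiset.card lam.parts - 2), (Polynomial.X : Qmt) ^ i) *
          ∏ p ∈ lam.parts.toFinset,
            plethH (lam.parts.count p) (if p < n then Qplus p else 0)) =
      (Polynomial.X ^ 2 - Polynomial.X ^ (Multiset.card lam.parts)) *
        (∏ p ∈ lam.parts.toFinset, plethH (lam.parts.count p) (Qplus p)) -
      if lam = Nat.Partition.indiscrete n then
        (Polynomial.X ^ 2 - Polynomial.X) * Qplus n else 0 := by
    intro lam
    split_ifs with h
    · subst h
      simp [Nat.Partition.indiscrete_parts hn0, plethH_one]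
    · have hc : Multiset.card lam.parts ≠ 1 := fun hc => h ((card_parts_eq_one_iff hn0 lam).mp hc)
      have hc0 : Multiset.card lam.parts ≠ 0 := by
        intro h0
        have := lam.parts_sum
        rw [Multiset.card_eq_zero.mp h0] at this
        simp at this
        omega
      rw [← mul_assoc, X_mul_one_sub_X_mul_sum_Icc, sub_zero,
        Nat.sub_add_cancel (by omega)]
      congr 1
      refine Finset.prod_congr rfl fun p hp => ?_
      rw [if_pos]
      have hp' := Multiset.mem_toFinset.mp hp
      refine lt_of_le_of_ne (lam.le_of_mem_parts hp') ?_
      rintro rfl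
      obtain ⟨t, ht⟩ := Multiset.exists_cons_of_mem hp'
      have hs := lam.parts_sum
      rw [ht, Multiset.sum_cons] at hs
      have ht0 : ∀ x ∈ t, x = 0 := Multiset.sum_eq_zero_iff.mp (by omega)
      have ht1 : t = 0 := by
        refine Multiset.eq_zero_of_forall_notMem fun x hx => ?_
        have := lam.parts_pos (i := x) (by rw [ht]; exact Multiset.mem_cons_of_mem hx)
        have := ht0 x hx
        omega
      rw [ht, ht1] at hc
      simp at hc
  have h4 : (Polynomial.X : Qmt) * (1 - Polynomial.X) * Qplus n =
      Polynomial.X ^ 2 * Qfull n - PowerSeries.coeff n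
        (plethSeries fun p => Polynomial.X * Qplus p) -
        (Polynomial.X ^ 2 - Polynomial.X) * Qplus n := by
    conv_lhs => rw [h2]
    rw [Finset.mul_sum, Finset.sum_congr rfl fun lam _ => h3 lam, Finset.sum_sub_distrib, h1,
      Finset.sum_ite_eq' Finset.univ (Nat.Partition.indiscrete n), if_pos (Finset.mem_univ _),
      Qfull, if_neg (by omega), Finset.mul_sum, ← Finset.sum_sub_distrib]
    simp only [sub_mul]
  linear_combination h4

lemma coeff_zero_plethSeries (g : ℕ → Qmt) : PowerSeries.coeff 0 (plethSeries g) = 1 := by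
  rw [plethSeries, Nat.Partition.coeff_genFun]
  simp

lemma coeff_one_plethSeries (g : ℕ → Qmt) : PowerSeries.coeff 1 (plethSeries g) = g 1 := by
  rw [plethSeries, Nat.Partition.coeff_genFun]
  simp [Finsupp.prod, plethH_one]

end Plethysm

/-- All coefficients of `f ∈ ℚ[m][t]` have degree at most `n` in `m`. -/
def MDegreeLE (n : ℕ) (f : Qmt) : Prop := ∀ k, (f.coeff k).natDegree ≤ n

section MDegree

lemma MDegreeLE.mono {a b : ℕ} (h : a ≤ b) {f : Qmt} (hf : MDegreeLE a f) : MDegreeLE b f :=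
  fun k => (hf k).trans h

lemma MDegreeLE.mul {a b : ℕ} {f g : Qmt} (hf : MDegreeLE a f) (hg : MDegreeLE b g) :
    MDegreeLE (a + b) (f * g) := by
  intro k
  rw [Polynomial.coeff_mul]
  exact Polynomial.natDegree_sum_le_of_forall_le _ _ fun p _ =>
    Polynomial.natDegree_mul_le_of_le (hf _) (hg _)

lemma MDegreeLE.smul {a : ℕ} {f : Qmt} (c : ℚ) (hf : MDegreeLE a f) : MDegreeLE a (c • f) := by
  intro k
  rw [Polynomial.coeff_smul]
  exact (Polynomial.natDegree_smul_le _ _).trans (hf k)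

lemma MDegreeLE.sum {a : ℕ} {ι : Type*} (s : Finset ι) (f : ι → Qmt)
    (h : ∀ i ∈ s, MDegreeLE a (f i)) : MDegreeLE a (∑ i ∈ s, f i) := by
  intro k
  rw [Polynomial.finsetSum_coeff]
  exact Polynomial.natDegree_sum_le_of_forall_le _ _ fun i hi => h i hi k

lemma MDegreeLE.zero (a : ℕ) : MDegreeLE a 0 := fun k => by simp

lemma MDegreeLE.one (a : ℕ) : MDegreeLE a 1 := fun k => by
  rw [Polynomial.coeff_one]
  split_ifs <;> simp

lemma MDegreeLE.X_pow (i : ℕ) : MDegreeLE 0 (Polynomial.X ^ i) := fun k => by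
  rw [Polynomial.coeff_X_pow]
  split_ifs <;> simp

lemma MDegreeLE.mPoly : MDegreeLE 1 mPoly := fun k => by
  rw [_root_.mPoly, Polynomial.coeff_C]
  split_ifs <;> simp

lemma MDegreeLE.prod {ι : Type*} (s : Finset ι) (f : ι → Qmt) (a : ι → ℕ)
    (h : ∀ i ∈ s, MDegreeLE (a i) (f i)) : MDegreeLE (∑ i ∈ s, a i) (∏ i ∈ s, f i) := by
  classical
  induction s using Finset.induction_on with
  | empty => exact MDegreeLE.one _
  | insert b s hb ih =>
    rw [Finset.prod_insert hb, Finset.sum_insert hb]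
    exact (h b (Finset.mem_insert_self b s)).mul
      (ih fun i hi => h i (Finset.mem_insert_of_mem hi))

lemma coeff_tPow (d : ℕ) (hd : 0 < d) (f : Qmt) (k : ℕ) :
    (tPow d f).coeff k = if d ∣ k then f.coeff (k / d) else 0 := by
  rw [tPow, ← Polynomial.expand_eq_comp_X_pow, Polynomial.coeff_expand hd]

lemma MDegreeLE.tPow {a : ℕ} {f : Qmt} (hf : MDegreeLE a f) (d : ℕ) (hd : 0 < d) :
    MDegreeLE a (tPow d f) := by
  intro k
  rw [coeff_tPow d hd]
  split_ifs
  · exact hf _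
  · simp

lemma MDegreeLE.tPowMul {a : ℕ} {f : Qmt} (hf : MDegreeLE a f) (s : Multiset ℕ)
    (hs : ∀ i ∈ s, 0 < i) : MDegreeLE (a * s.sum) (tPowMul s f) := by
  induction s using Multiset.induction_on with
  | empty => exact MDegreeLE.one _
  | cons d s ih =>
    rw [_root_.tPowMul, Multiset.map_cons, Multiset.prod_cons, Multiset.sum_cons, mul_add]
    have hd := hs d (Multiset.mem_cons_self d s)
    exact ((hf.tPow d hd).mono (Nat.le_mul_of_pos_right a hd)).mul
      (ih fun i hi => hs i (Multiset.mem_cons_of_mem hi))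

lemma MDegreeLE.plethH {a : ℕ} {f : Qmt} (hf : MDegreeLE a f) (r : ℕ) :
    MDegreeLE (a * r) (plethH r f) := by
  refine MDegreeLE.sum _ _ fun μ _ => ?_
  have h := hf.tPowMul μ.parts fun i hi => μ.parts_pos hi
  rw [μ.parts_sum] at h
  have h2 := h.smul ((zPart μ.parts : ℚ)⁻¹)
  rw [Algebra.smul_def] at h2
  exact h2

lemma MDegreeLE.prod_plethH {n : ℕ} (lam : n.Partition) (g : ℕ → Qmt)
    (hg : ∀ p ∈ lam.parts, MDegreeLE p (g p)) :
    MDegreeLE n (∏ p ∈ lam.parts.toFinset, _root_.plethH (lam.parts.count p) (g p)) := by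
  have h := MDegreeLE.prod lam.parts.toFinset
    (fun p => _root_.plethH (lam.parts.count p) (g p)) (fun p => p * lam.parts.count p)
    fun p hp => (hg p (Multiset.mem_toFinset.mp hp)).plethH _
  have hs : ∑ p ∈ lam.parts.toFinset, p * lam.parts.count p = n := by
    conv_rhs => rw [← lam.parts_sum]
    rw [Finset.sum_multiset_count]
    exact Finset.sum_congr rfl fun p _ => by rw [smul_eq_mul, mul_comm]
  rwa [hs] at h

lemma MDegreeLE.Qplus (n : ℕ) : MDegreeLE n (Qplus n) := by
  induction n using Nat.strong_induction_on with
  | _ n ih =>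
    rw [Qplus_eq]
    split_ifs with h
    · rw [h]
      exact MDegreeLE.mPoly
    · refine MDegreeLE.sum _ _ fun lam _ => ?_
      refine ((MDegreeLE.sum _ _ fun i _ => MDegreeLE.X_pow i).mul
        (MDegreeLE.prod_plethH lam _ fun p _ => ?_)).mono (zero_add n).le
      split_ifs with hp
      · exact ih p hp
      · exact MDegreeLE.zero _

lemma MDegreeLE.coeff_plethSeries (g : ℕ → Qmt) (hg : ∀ p, MDegreeLE p (g p)) (n : ℕ) :
    MDegreeLE n (PowerSeries.coeff n (plethSeries g)) := by
  rw [plethSeries, Nat.Partition.coeff_genFun]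
  exact MDegreeLE.sum _ _ fun lam _ => MDegreeLE.prod_plethH lam g fun p _ => hg p

end MDegree

section Growth

open PowerSeries

/-- Power series whose coefficients are bounded in absolute value by those of `p(x) e^{rx}`, for
some polynomial `p` with nonnegative coefficients. -/
noncomputable def expBounded (r : ℕ) : Submodule ℚ ℚ⟦X⟧ where
  carrier := {f | ∃ p : Polynomial ℚ, (∀ i, 0 ≤ p.coeff i) ∧
    ∀ n, |PowerSeries.coeff n f| ≤ PowerSeries.coeff n ((p : ℚ⟦X⟧) * rescale (r : ℚ) (exp ℚ))}
  zero_mem' := ⟨0, by simp, by simp⟩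
  add_mem' := by
    rintro f g ⟨p, hp, hf⟩ ⟨q, hq, hg⟩
    refine ⟨p + q, fun i => by simpa using add_nonneg (hp i) (hq i), fun n => ?_⟩
    rw [Polynomial.coe_add, add_mul, map_add, map_add]
    exact (abs_add_le _ _).trans (add_le_add (hf n) (hg n))
  smul_mem' := by
    rintro c f ⟨p, hp, hf⟩
    refine ⟨Polynomial.C |c| * p, fun i => ?_, fun n => ?_⟩
    · rw [Polynomial.coeff_C_mul]
      exact mul_nonneg (abs_nonneg c) (hp i)
    · rw [Polynomial.coe_mul, Polynomial.coe_C, mul_assoc, PowerSeries.coeff_C_mul, map_smul,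
        smul_eq_mul,
        abs_mul]
      exact mul_le_mul_of_nonneg_left (hf n) (abs_nonneg c)

lemma expBounded_mono {r s : ℕ} (h : r ≤ s) : expBounded r ≤ expBounded s := by
  rintro f ⟨p, hp, hf⟩
  refine ⟨p, hp, fun n => (hf n).trans ?_⟩
  rw [PowerSeries.coeff_mul, PowerSeries.coeff_mul]
  refine Finset.sum_le_sum fun a _ => ?_
  rw [Polynomial.coeff_coe, coeff_rescale, coeff_rescale, coeff_exp]
  have := hp a.1
  simp only [Algebra.algebraMap_self, RingHom.id_apply]
  gcongr

lemma expBounded_mul_mem {r s : ℕ} {f g : ℚ⟦X⟧} (hf : f ∈ expBounded r) (hg : g ∈ expBounded s) :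
    f * g ∈ expBounded (r + s) := by
  obtain ⟨p, hp, hf⟩ := hf
  obtain ⟨q, hq, hg⟩ := hg
  refine ⟨p * q, fun i => ?_, fun n => ?_⟩
  · rw [Polynomial.coeff_mul]
    exact Finset.sum_nonneg fun a _ => mul_nonneg (hp _) (hq _)
  · have h : ((p * q : Polynomial ℚ) : ℚ⟦X⟧) * rescale ((r + s : ℕ) : ℚ) (exp ℚ) =
        (p * rescale (r : ℚ) (exp ℚ)) * (q * rescale (s : ℚ) (exp ℚ)) := by
      rw [Nat.cast_add, ← exp_mul_exp_eq_exp_add, Polynomial.coe_mul]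
      ring
    rw [h, PowerSeries.coeff_mul, PowerSeries.coeff_mul]
    refine (Finset.abs_sum_le_sum_abs _ _).trans (Finset.sum_le_sum fun a _ => ?_)
    rw [abs_mul]
    exact mul_le_mul (hf _) (hg _) (abs_nonneg _) ((abs_nonneg _).trans (hf _))

lemma expBounded_zero_of_eventually_zero {f : ℚ⟦X⟧} (N : ℕ)
    (h : ∀ n, N < n → PowerSeries.coeff n f = 0) :
    f ∈ expBounded 0 := by
  refine ⟨∑ i ∈ Finset.range (N + 1), Polynomial.monomial i |PowerSeries.coeff i f|, fun i => ?_,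
      fun n => ?_⟩
  · rw [Polynomial.finsetSum_coeff]
    refine Finset.sum_nonneg fun j _ => ?_
    rw [Polynomial.coeff_monomial]
    split_ifs <;> simp
  · have : rescale ((0 : ℕ) : ℚ) (exp ℚ) = 1 := by
      ext n
      rw [coeff_rescale, PowerSeries.coeff_one]
      split_ifs with h <;> simp [h]
    rw [this, mul_one, Polynomial.coeff_coe, Polynomial.finsetSum_coeff]
    simp only [Polynomial.coeff_monomial]
    rw [Finset.sum_ite_eq']
    split_ifs with hn
    · rfl
    · rw [h n (by simpa using hn), abs_zero]

/-- The series `Σ_n [m^{n-j}] h_n x^n` (when `h_n` has degree at most `n`). -/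
noncomputable def codegreeCoeff (j : ℕ) : (Polynomial ℚ)⟦X⟧ →ₗ[ℚ] ℚ⟦X⟧ where
  toFun h := mk fun n => (Polynomial.reflect n (PowerSeries.coeff n h)).coeff j
  map_add' f g := by
    ext n
    simp
  map_smul' c f := by
    ext n
    simp [Polynomial.coeff_reflect]

lemma coeff_codegreeCoeff (j n : ℕ) (h : (Polynomial ℚ)⟦X⟧) :
    PowerSeries.coeff n (codegreeCoeff j h) =
      (Polynomial.reflect n (PowerSeries.coeff n h)).coeff j := by
  simp [codegreeCoeff]

lemma coeff_codegreeCoeff_of_le {j n : ℕ} (hj : j ≤ n) (h : (Polynomial ℚ)⟦X⟧) :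
    PowerSeries.coeff n (codegreeCoeff j h) = (PowerSeries.coeff n h).coeff (n - j) := by
  rw [coeff_codegreeCoeff, Polynomial.coeff_reflect, Polynomial.revAt_le hj]

lemma codegreeCoeff_mul {f g : (Polynomial ℚ)⟦X⟧} (hf : ∀ n, (PowerSeries.coeff n f).natDegree ≤ n)
    (hg : ∀ n, (PowerSeries.coeff n g).natDegree ≤ n) (j : ℕ) :
    codegreeCoeff j (f * g) = ∑ p ∈ Finset.HasAntidiagonal.antidiagonal j,
      codegreeCoeff p.1 f * codegreeCoeff p.2 g := by
  ext n
  rw [coeff_codegreeCoeff, PowerSeries.coeff_mul, map_sum]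
  have h : ∀ p ∈ Finset.HasAntidiagonal.antidiagonal n,
      Polynomial.reflect n (PowerSeries.coeff p.1 f * PowerSeries.coeff p.2 g) =
        Polynomial.reflect p.1 (PowerSeries.coeff p.1 f) * Polynomial.reflect p.2
          (PowerSeries.coeff p.2 g) := by
    intro p hp
    rw [← Polynomial.reflect_mul _ _ (hf _) (hg _),
      Finset.HasAntidiagonal.mem_antidiagonal.mp hp]
  have h2 : Polynomial.reflect n (∑ p ∈ Finset.HasAntidiagonal.antidiagonal n,
      PowerSeries.coeff p.1 f * PowerSeries.coeff p.2 g) =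
        ∑ p ∈ Finset.HasAntidiagonal.antidiagonal n,
        Polynomial.reflect p.1 (PowerSeries.coeff p.1 f) * Polynomial.reflect p.2
          (PowerSeries.coeff p.2 g) := by
    rw [← Finset.sum_congr rfl h]
    ext i
    simp [Polynomial.coeff_reflect]
  rw [h2, Polynomial.finsetSum_coeff]
  simp only [Polynomial.coeff_mul, PowerSeries.coeff_mul, coeff_codegreeCoeff]
  rw [Finset.sum_comm]

/-- Series `Σ_n h_n(m) x^n` with `h_n` of degree at most `n`, all of whose series of coefficients
of fixed codegree grow at most like `p(x) e^{rx}`. -/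
noncomputable def growth (r : ℕ) : Submodule ℚ (Polynomial ℚ)⟦X⟧ where
  carrier := {h | (∀ n, (PowerSeries.coeff n h).natDegree ≤ n) ∧ ∀ j,
    codegreeCoeff j h ∈ expBounded r}
  zero_mem' := ⟨by simp, by simp⟩
  add_mem' := by
    rintro f g ⟨hf, hf'⟩ ⟨hg, hg'⟩
    refine ⟨fun n => ?_, fun j => ?_⟩
    · rw [map_add]
      exact Polynomial.natDegree_add_le_of_degree_le (hf n) (hg n)
    · rw [map_add]
      exact add_mem (hf' j) (hg' j)
  smul_mem' := by
    rintro c f ⟨hf, hf'⟩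
    refine ⟨fun n => ?_, fun j => ?_⟩
    · exact (Polynomial.natDegree_smul_le c (PowerSeries.coeff n f)).trans (hf n)
    · rw [map_smul]
      exact Submodule.smul_mem _ _ (hf' j)

lemma growth_mono {r s : ℕ} (h : r ≤ s) : growth r ≤ growth s :=
  fun _ hf => ⟨hf.1, fun j => expBounded_mono h (hf.2 j)⟩

lemma growth_mul_mem {r s : ℕ} {f g : (Polynomial ℚ)⟦X⟧} (hf : f ∈ growth r) (hg : g ∈ growth s) :
    f * g ∈ growth (r + s) := by
  refine ⟨fun n => ?_, fun j => ?_⟩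
  · rw [PowerSeries.coeff_mul]
    refine Polynomial.natDegree_sum_le_of_forall_le _ _ fun p hp => ?_
    rw [← Finset.HasAntidiagonal.mem_antidiagonal.mp hp]
    exact Polynomial.natDegree_mul_le_of_le (hf.1 _) (hg.1 _)
  · rw [codegreeCoeff_mul hf.1 hg.1]
    exact sum_mem fun p _ => expBounded_mul_mem (hf.2 _) (hg.2 _)

lemma mem_growth_zero_of_two_mul_natDegree_le {h : (Polynomial ℚ)⟦X⟧}
    (hh : ∀ n, 2 * (PowerSeries.coeff n h).natDegree ≤ n) : h ∈ growth 0 := by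
  refine ⟨fun n => ?_, fun j => ?_⟩
  · have := hh n
    omega
  · refine expBounded_zero_of_eventually_zero (2 * j) fun n hn => ?_
    rw [coeff_codegreeCoeff_of_le (by omega)]
    refine Polynomial.coeff_eq_zero_of_natDegree_lt ?_
    have := hh n
    omega

lemma one_mem_growth_zero : (1 : (Polynomial ℚ)⟦X⟧) ∈ growth 0 := by
  refine mem_growth_zero_of_two_mul_natDegree_le fun n => ?_
  rw [PowerSeries.coeff_one]
  split_ifs <;> simp

lemma X_mul_C_X_mem_growth_zero : (PowerSeries.X * PowerSeries.C Polynomial.X :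
    (Polynomial ℚ)⟦X⟧) ∈ growth 0 := by
  have h : ∀ n, PowerSeries.coeff n (PowerSeries.X * PowerSeries.C Polynomial.X :
      (Polynomial ℚ)⟦X⟧) =
      if n = 1 then Polynomial.X else 0 := by
    intro n
    rw [mul_comm, PowerSeries.coeff_C_mul, PowerSeries.coeff_X]
    split_ifs <;> simp
  refine ⟨fun n => ?_, fun j => expBounded_zero_of_eventually_zero 1 fun n hn => ?_⟩
  · rw [h]
    split_ifs with h1 <;> simp [h1]
  · rw [coeff_codegreeCoeff, h, if_neg (by omega)]
    simp

end Growth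

/-- The generating series of the coefficients of `t^k` in a sequence of polynomials. -/
noncomputable def tSlice (k : ℕ) (g : ℕ → Qmt) : PowerSeries (Polynomial ℚ) :=
  PowerSeries.mk fun n => (g n).coeff k

/-- The `t^k`-slice of `Σ_n 𝒬_n x^n`. -/
noncomputable def qSlice (k : ℕ) : PowerSeries (Polynomial ℚ) := tSlice k Qfull

/-- The `t^k`-slice of the plethystic exponential of `t 𝒬⁺`. -/
noncomputable def uSlice (k : ℕ) : PowerSeries (Polynomial ℚ) :=
  tSlice k fun n => PowerSeries.coeff n (plethSeries fun p => Polynomial.X * Qplus p)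

section Slices

open PowerSeries

lemma coeff_tSlice (k n : ℕ) (g : ℕ → Qmt) : PowerSeries.coeff n (tSlice k g) = (g n).coeff k := by
  rw [tSlice, coeff_mk]

lemma coeff_rat_smul (c : ℚ) (n : ℕ) (f : (Polynomial ℚ)⟦X⟧) :
    PowerSeries.coeff n (c • f) = c • PowerSeries.coeff n f := rfl

lemma tSlice_plethSeries_succ (g : ℕ → Qmt) (k : ℕ) :
    ((k : ℚ) + 1) • tSlice (k + 1) (fun n => PowerSeries.coeff n (plethSeries g)) =
      ∑ p ∈ Finset.HasAntidiagonal.antidiagonal k,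
        ((p.2 : ℚ) + 1) • (tSlice p.1 (fun n => PowerSeries.coeff n (plethSeries g)) *
          tSlice (p.2 + 1) (logPleth g)) := by
  ext1 n
  have h := congrArg (fun f => Polynomial.coeff f k) (derivative_coeff_plethSeries g n)
  simp only [Polynomial.coeff_derivative, Polynomial.finsetSum_coeff, Polynomial.coeff_mul] at h
  rw [Finset.sum_comm] at h
  have hs : ∀ (c : ℕ) (f : Polynomial ℚ), ((c : ℚ) + 1) • f = f * ((c : Polynomial ℚ) + 1) := by
    intro c f
    rw [Algebra.smul_def, mul_comm]
    simp
  rw [coeff_rat_smul, coeff_tSlice, hs, h, map_sum]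
  refine Finset.sum_congr rfl fun p _ => ?_
  rw [coeff_rat_smul, PowerSeries.coeff_mul, hs, Finset.sum_mul]
  simp only [coeff_tSlice, mul_assoc]

lemma qSlice_succ (k : ℕ) : ((k : ℚ) + 1) • qSlice (k + 1) =
      ∑ p ∈ Finset.HasAntidiagonal.antidiagonal k,
        ((p.2 : ℚ) + 1) • (qSlice p.1 * tSlice (p.2 + 1) (logPleth Qplus)) := by
  have h : (Qfull : ℕ → Qmt) = fun n => PowerSeries.coeff n (plethSeries Qplus) := funext Qfull_eq
  simp only [qSlice, h]
  exact tSlice_plethSeries_succ Qplus k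

lemma uSlice_succ (k : ℕ) : ((k : ℚ) + 1) • uSlice (k + 1) =
      ∑ p ∈ Finset.HasAntidiagonal.antidiagonal k,
        ((p.2 : ℚ) + 1) • (uSlice p.1 *
          tSlice (p.2 + 1) (logPleth fun p => Polynomial.X * Qplus p)) :=
  tSlice_plethSeries_succ _ k

lemma Qplus_zero : Qplus 0 = 0 := by
  rw [Qplus_eq]
  simp

lemma mDegreeLE_logPleth_sub (g : ℕ → Qmt) (hg : ∀ p, MDegreeLE p (g p)) (hg0 : g 0 = 0) (b : ℕ) :
    MDegreeLE (b / 2) (logPleth g b - g b) := by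
  rcases Nat.eq_zero_or_pos b with rfl | hb
  · rw [hg0, logPleth]
    simpa using MDegreeLE.zero 0
  · have hb' : b ∈ b.divisors := Nat.mem_divisors_self b hb.ne'
    have h1 : (((b / b : ℕ) : ℚ)⁻¹) • tPow (b / b) (g b) = g b := by
      rw [Nat.div_self hb]
      simp [tPow]
    rw [logPleth, ← Finset.add_sum_erase _ _ hb', h1, add_sub_cancel_left]
    refine MDegreeLE.sum _ _ fun p hp => MDegreeLE.smul _ ?_
    obtain ⟨hpb, hp⟩ := Finset.mem_erase.mp hp
    obtain ⟨⟨d, rfl⟩, -⟩ := Nat.mem_divisors.mp hp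
    have hp0 : 0 < p := Nat.pos_of_mul_pos_right hb
    rw [Nat.mul_div_cancel_left d hp0]
    have hd0 : d ≠ 0 := by
      rintro rfl
      simp at hb
    have hd1 : d ≠ 1 := by
      rintro rfl
      simp at hpb
    refine ((hg p).tPow d (Nat.pos_of_ne_zero hd0)).mono ?_
    rw [Nat.le_div_iff_mul_le two_pos]
    exact Nat.mul_le_mul_left p (by omega)

lemma tSlice_mem_growth_zero {g : ℕ → Qmt} (hg : ∀ b, MDegreeLE (b / 2) (g b)) (k : ℕ) :
    tSlice k g ∈ growth 0 := by
  refine mem_growth_zero_of_two_mul_natDegree_le fun n => ?_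
  rw [coeff_tSlice]
  have := hg n k
  omega

lemma tSlice_logPleth_sub_mem (k : ℕ) :
    tSlice k (logPleth Qplus) - tSlice k Qplus ∈ growth 0 := by
  have h := tSlice_mem_growth_zero (mDegreeLE_logPleth_sub Qplus MDegreeLE.Qplus Qplus_zero) k
  convert h using 1
  ext1 n
  simp [coeff_tSlice]

lemma tSlice_logPleth_X_mul_sub_mem (k : ℕ) :
    tSlice (k + 1) (logPleth fun p => Polynomial.X * Qplus p) - tSlice k Qplus ∈ growth 0 := by
  have h1 : ∀ p, MDegreeLE p (Polynomial.X * Qplus p) := fun p => by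
    simpa using (MDegreeLE.X_pow 1).mul (MDegreeLE.Qplus p)
  have h := tSlice_mem_growth_zero (mDegreeLE_logPleth_sub (fun p => Polynomial.X * Qplus p) h1
    (by rw [Qplus_zero, mul_zero])) (k + 1)
  convert h using 1
  ext1 n
  simp [coeff_tSlice]

lemma uSlice_zero : uSlice 0 = 1 := by
  ext1 n
  rw [uSlice, coeff_tSlice, PowerSeries.coeff_one]
  match n with
  | 0 => simp [coeff_zero_plethSeries]
  | 1 => simp [coeff_one_plethSeries]
  | n + 2 =>
    rw [coeff_plethSeries_X_mul_Qplus _ (by omega)]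
    simp

lemma uSlice_one : uSlice 1 = PowerSeries.X * PowerSeries.C Polynomial.X := by
  ext1 n
  rw [uSlice, coeff_tSlice, PowerSeries.coeff_mul_C, PowerSeries.coeff_X]
  match n with
  | 0 => simp [coeff_zero_plethSeries, Polynomial.coeff_one]
  | 1 => simp [coeff_one_plethSeries, Qplus_eq 1, mPoly]
  | n + 2 =>
    rw [coeff_plethSeries_X_mul_Qplus _ (by omega)]
    simp [Polynomial.coeff_X_pow_mul']

lemma coeff_uSlice_add_two (k n : ℕ) :
    PowerSeries.coeff n (uSlice (k + 2)) = if 2 ≤ n then (Qfull n).coeff k else 0 := by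
  rw [uSlice, coeff_tSlice]
  match n with
  | 0 => simp [coeff_zero_plethSeries, Polynomial.coeff_one]
  | 1 => simp [coeff_one_plethSeries, Qplus_eq 1, mPoly]
  | n + 2 =>
    rw [coeff_plethSeries_X_mul_Qplus _ (by omega), Polynomial.coeff_X_pow_mul']
    simp

lemma MDegreeLE.Qfull (n : ℕ) : MDegreeLE n (Qfull n) := by
  rw [Qfull_eq]
  exact MDegreeLE.coeff_plethSeries _ MDegreeLE.Qplus n

lemma qSlice_sub_uSlice_mem (k : ℕ) : qSlice k - uSlice (k + 2) ∈ growth 0 := by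
  have h : ∀ n, PowerSeries.coeff n (qSlice k - uSlice (k + 2)) = if 2 ≤ n then 0 else
      (Qfull n).coeff k := by
    intro n
    rw [map_sub, coeff_uSlice_add_two, qSlice, coeff_tSlice]
    split_ifs <;> simp
  refine ⟨fun n => ?_, fun j => expBounded_zero_of_eventually_zero 1 fun n hn => ?_⟩
  · rw [h]
    split_ifs
    · simp
    · exact MDegreeLE.Qfull n k
  · rw [coeff_codegreeCoeff, h, if_pos (by omega)]
    simp

end Slices

section BaseSlice

open PowerSeries

lemma coeff_zero_Qplus (p : ℕ) : (Qplus p).coeff 0 = if p = 1 then Polynomial.X else 0 := by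
  rw [Qplus_eq]
  split_ifs with h
  · simp [mPoly]
  · rw [Polynomial.finsetSum_coeff]
    refine Finset.sum_eq_zero fun lam _ => ?_
    rw [Polynomial.mul_coeff_zero, Polynomial.finsetSum_coeff, Finset.sum_eq_zero, zero_mul]
    intro i hi
    rw [Polynomial.coeff_X_pow, if_neg]
    have := (Finset.mem_Icc.mp hi).1
    omega

lemma natCast_mul_coeff_zero_logPleth_Qplus (b : ℕ) :
    (b : Polynomial ℚ) * (logPleth Qplus b).coeff 0 = if b = 0 then 0 else Polynomial.X := by
  split_ifs with hb
  · simp [hb]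
  · have h : ∀ p ∈ b.divisors, ((((b / p : ℕ) : ℚ)⁻¹) • tPow (b / p) (Qplus p)).coeff 0 =
        if p = 1 then ((b : ℚ)⁻¹) • Polynomial.X else 0 := by
      intro p hp
      obtain ⟨hpb, hb⟩ := Nat.mem_divisors.mp hp
      rw [Polynomial.coeff_smul, coeff_tPow _ (Nat.div_pos (Nat.le_of_dvd (by omega) hpb)
        (Nat.pos_of_dvd_of_pos hpb (by omega))), if_pos (dvd_zero _), Nat.zero_div,
        coeff_zero_Qplus]
      split_ifs with h1
      · rw [h1, Nat.div_one]
      · rw [smul_zero]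
    rw [logPleth, Polynomial.finsetSum_coeff, Finset.sum_congr rfl h, Finset.sum_ite_eq',
      if_pos (Nat.one_mem_divisors.mpr hb), Algebra.smul_def, ← mul_assoc]
    have : (b : Polynomial ℚ) = algebraMap ℚ (Polynomial ℚ) b := by simp
    rw [this, ← map_mul, mul_inv_cancel₀ (by exact_mod_cast hb), map_one, one_mul]

lemma natCast_mul_coeff_qSlice_zero (n : ℕ) : (n : Polynomial ℚ) * PowerSeries.coeff n (qSlice 0) =
    Polynomial.X * ∑ a ∈ Finset.range n, PowerSeries.coeff a (qSlice 0) := by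
  have h := congrArg (fun f => Polynomial.coeff f 0) (natCast_mul_coeff_plethSeries Qplus n)
  simp only [Polynomial.mul_coeff_zero, Polynomial.finsetSum_coeff, ← Qfull_eq,
    Polynomial.coeff_natCast_ite, if_true] at h
  rw [qSlice]
  simp only [coeff_tSlice]
  rw [h, Finset.Nat.sum_antidiagonal_eq_sum_range_succ_mk, Finset.sum_range_succ,
    natCast_mul_coeff_zero_logPleth_Qplus, if_pos (Nat.sub_self n), mul_zero, add_zero,
    Finset.mul_sum]
  refine Finset.sum_congr rfl fun a ha => ?_
  have := Finset.mem_range.mp ha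
  rw [natCast_mul_coeff_zero_logPleth_Qplus, if_neg (by omega), mul_comm]

lemma one_sub_X_mul_derivative_qSlice_zero :
    (1 - PowerSeries.X) * d⁄dX (Polynomial ℚ) (qSlice 0) = PowerSeries.C Polynomial.X *
      qSlice 0 := by
  ext1 n
  rw [sub_mul, one_mul, map_sub, PowerSeries.coeff_C_mul, PowerSeries.coeff_derivative]
  have h1 := natCast_mul_coeff_qSlice_zero (n + 1)
  have h2 := natCast_mul_coeff_qSlice_zero n
  rw [Finset.sum_range_succ, mul_add, ← h2] at h1
  have h3 : PowerSeries.coeff n (PowerSeries.X * d⁄dX (Polynomial ℚ) (qSlice 0)) =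
      n * PowerSeries.coeff n (qSlice 0) := by
    cases n with
    | zero => simp
    | succ n =>
      rw [PowerSeries.coeff_succ_X_mul, PowerSeries.coeff_derivative]
      push_cast
      ring
  rw [h3]
  push_cast at h1
  linear_combination h1

lemma coeff_zero_qSlice_zero : PowerSeries.coeff 0 (qSlice 0) = 1 := by
  rw [qSlice, coeff_tSlice, Qfull_eq, coeff_zero_plethSeries, Polynomial.coeff_one_zero]

lemma coeff_zero_qSlice_zero_pow (r : ℕ) : PowerSeries.coeff 0 (qSlice 0 ^ r) = 1 := by
  have h := coeff_zero_qSlice_zero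
  rw [coeff_zero_eq_constantCoeff_apply] at h ⊢
  rw [map_pow, h, one_pow]

lemma coeff_succ_qSlice_zero_pow (r n : ℕ) :
    ((n : Polynomial ℚ) + 1) * PowerSeries.coeff (n + 1) (qSlice 0 ^ r) =
      ((n : Polynomial ℚ) + (r : Polynomial ℚ) * Polynomial.X) * PowerSeries.coeff n
        (qSlice 0 ^ r) := by
  have h : (1 - PowerSeries.X) * d⁄dX (Polynomial ℚ) (qSlice 0 ^ r) =
      PowerSeries.C ((r : Polynomial ℚ) * Polynomial.X) * qSlice 0 ^ r := by
    cases r with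
    | zero => simp
    | succ r =>
      rw [PowerSeries.derivative_pow, Nat.add_sub_cancel, map_mul, map_natCast, Nat.cast_succ]
      linear_combination ((r : (Polynomial ℚ)⟦X⟧) + 1) * qSlice 0 ^ r *
        one_sub_X_mul_derivative_qSlice_zero
  have h2 := congrArg (PowerSeries.coeff n) h
  rw [sub_mul, one_mul, map_sub, PowerSeries.coeff_C_mul, PowerSeries.coeff_derivative] at h2
  have h3 : PowerSeries.coeff n (PowerSeries.X * d⁄dX (Polynomial ℚ) (qSlice 0 ^ r)) = n *
      PowerSeries.coeff n (qSlice 0 ^ r) := by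
    cases n with
    | zero => simp
    | succ n =>
      rw [PowerSeries.coeff_succ_X_mul, PowerSeries.coeff_derivative]
      push_cast
      ring
  rw [h3] at h2
  linear_combination h2

lemma coeff_coeff_succ_qSlice_zero_pow (r n i : ℕ) :
    ((n : ℚ) + 1) * (PowerSeries.coeff (n + 1) (qSlice 0 ^ r)).coeff (i + 1) =
      n * (PowerSeries.coeff n (qSlice 0 ^ r)).coeff (i + 1) + r *
        (PowerSeries.coeff n (qSlice 0 ^ r)).coeff i := by
  have h := congrArg (fun f : Polynomial ℚ => f.coeff (i + 1)) (coeff_succ_qSlice_zero_pow r n)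
  simp only [add_mul, one_mul, mul_assoc, Polynomial.coeff_add, Polynomial.coeff_natCast_mul,
    Polynomial.coeff_X_mul] at h
  linear_combination h

lemma coeff_zero_coeff_succ_qSlice_zero_pow (r n : ℕ) :
    ((n : ℚ) + 1) * (PowerSeries.coeff (n + 1) (qSlice 0 ^ r)).coeff 0 =
      n * (PowerSeries.coeff n (qSlice 0 ^ r)).coeff 0 := by
  have h := congrArg (fun f : Polynomial ℚ => f.coeff 0) (coeff_succ_qSlice_zero_pow r n)
  simp only [add_mul, one_mul, mul_assoc, Polynomial.coeff_add, Polynomial.coeff_natCast_mul,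
    Polynomial.coeff_X_mul_zero, mul_zero, add_zero] at h
  linear_combination h

lemma coeff_coeff_qSlice_zero_pow_nonneg (r n i : ℕ) :
    0 ≤ (PowerSeries.coeff n (qSlice 0 ^ r)).coeff i := by
  induction n generalizing i with
  | zero =>
    rw [coeff_zero_qSlice_zero_pow, Polynomial.coeff_one]
    split_ifs <;> simp
  | succ n ih =>
    refine nonneg_of_mul_nonneg_right (a := (n : ℚ) + 1) ?_ (by positivity)
    cases i with
    | zero =>
      rw [coeff_zero_coeff_succ_qSlice_zero_pow]
      exact mul_nonneg (Nat.cast_nonneg n) (ih 0)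
    | succ i =>
      rw [coeff_coeff_succ_qSlice_zero_pow]
      exact add_nonneg (mul_nonneg (Nat.cast_nonneg n) (ih _))
        (mul_nonneg (Nat.cast_nonneg r) (ih _))

lemma pow_div_factorial_le_coeff_self (r n : ℕ) :
    (r : ℚ) ^ n / n.factorial ≤ (PowerSeries.coeff n (qSlice 0 ^ r)).coeff n := by
  induction n with
  | zero => simp [coeff_zero_qSlice_zero_pow]
  | succ n ih =>
    have h := coeff_coeff_succ_qSlice_zero_pow r n n
    have h1 := mul_nonneg (Nat.cast_nonneg (α := ℚ) n)
      (coeff_coeff_qSlice_zero_pow_nonneg r n (n + 1))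
    have h2 := mul_le_mul_of_nonneg_left ih (Nat.cast_nonneg (α := ℚ) r)
    have h3 : (r : ℚ) ^ (n + 1) / (n + 1).factorial =
        (r * (r ^ n / n.factorial)) / ((n : ℚ) + 1) := by
      rw [Nat.factorial_succ, pow_succ']
      push_cast
      field_simp
    rw [h3, div_le_iff₀ (by positivity)]
    linarith

lemma pow_div_factorial_le_coeff (r i j : ℕ) (hi : 1 ≤ i) :
    (r : ℚ) ^ i / (i + j).factorial ≤ (PowerSeries.coeff (i + j) (qSlice 0 ^ r)).coeff i := by
  induction j with
  | zero => exact pow_div_factorial_le_coeff_self r i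
  | succ j ih =>
    obtain ⟨i, rfl⟩ := Nat.exists_eq_add_of_le' hi
    have h := coeff_coeff_succ_qSlice_zero_pow r (i + 1 + j) i
    have h1 := mul_nonneg (Nat.cast_nonneg (α := ℚ) r)
      (coeff_coeff_qSlice_zero_pow_nonneg r (i + 1 + j) i)
    have hn : (1 : ℚ) ≤ ((i + 1 + j : ℕ) : ℚ) := by
      rw [Nat.one_le_cast]
      omega
    have h2 := mul_le_mul hn ih (by positivity) (by positivity)
    have h3 : (r : ℚ) ^ (i + 1) / (i + 1 + (j + 1)).factorial =
        (r ^ (i + 1) / (i + 1 + j).factorial) / (((i + 1 + j : ℕ) : ℚ) + 1) := by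
      rw [← add_assoc, Nat.factorial_succ (i + 1 + j), Nat.cast_mul, Nat.cast_succ]
      field_simp
    rw [h3, div_le_iff₀ (by positivity), ← add_assoc]
    linarith

lemma pow_div_factorial_le_coeff_codegreeCoeff (r j n : ℕ) (hn : j < n) :
    (r : ℚ) ^ (n - j) / n.factorial ≤ PowerSeries.coeff n (codegreeCoeff j (qSlice 0 ^ r)) := by
  rw [coeff_codegreeCoeff_of_le hn.le]
  have h := pow_div_factorial_le_coeff r (n - j) j (by omega)
  rwa [Nat.sub_add_cancel hn.le] at h

lemma natDegree_coeff_qSlice_le (k n : ℕ) : (PowerSeries.coeff n (qSlice k)).natDegree ≤ n := by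
  rw [qSlice, coeff_tSlice]
  exact MDegreeLE.Qfull n k

lemma factorial_mul_coeff_qSlice_zero_le (n i j : ℕ) (h : i + j = n) :
    (n.factorial : ℚ) * (PowerSeries.coeff n (qSlice 0)).coeff i ≤ (n : ℚ) ^ (2 * j) := by
  induction n generalizing i j with
  | zero =>
    obtain ⟨rfl, rfl⟩ : i = 0 ∧ j = 0 := by omega
    simp [coeff_zero_qSlice_zero]
  | succ n ih =>
    have hrec := fun i => coeff_coeff_succ_qSlice_zero_pow 1 n i
    have hrec0 := coeff_zero_coeff_succ_qSlice_zero_pow 1 n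
    simp only [pow_one, Nat.cast_one, one_mul] at hrec hrec0
    rw [Nat.factorial_succ, Nat.cast_mul, mul_right_comm, Nat.cast_succ]
    have hn : (0 : ℚ) ≤ n := Nat.cast_nonneg n
    have hpow : ∀ s : ℕ, (n : ℚ) * n ^ (2 * s) + n ^ (2 * (s + 1)) ≤
        ((n : ℚ) + 1) ^ (2 * (s + 1)) := by
      intro s
      have h1 : (n : ℚ) ^ (2 * s) ≤ (n + 1) ^ (2 * s) := by gcongr; linarith
      have h2 := mul_le_mul h1 (by nlinarith : (n : ℚ) + n ^ 2 ≤ (n + 1) ^ 2) (by positivity)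
        (by positivity)
      rw [mul_add, pow_add _ (2 * s), pow_add _ (2 * s), mul_one]
      linarith
    cases i with
    | zero =>
      rw [hrec0]
      obtain ⟨s, rfl⟩ : ∃ s, j = s + 1 := ⟨n, by omega⟩
      have h1 := mul_le_mul_of_nonneg_left (ih 0 s (by omega)) hn
      have h2 : (0 : ℚ) ≤ (n : ℚ) ^ (2 * (s + 1)) := by positivity
      linarith [hpow s]
    | succ i =>
      rw [hrec]
      have h1 := ih i j (by omega)
      cases j with
      | zero =>
        have h2 : (PowerSeries.coeff n (qSlice 0)).coeff (i + 1) = 0 :=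
          Polynomial.coeff_eq_zero_of_natDegree_lt
            ((natDegree_coeff_qSlice_le 0 n).trans_lt (by omega))
        rw [h2]
        simp only [mul_zero, pow_zero, zero_add] at h1 ⊢
        linarith
      | succ s =>
        have h2 := mul_le_mul_of_nonneg_left (ih (i + 1) s (by omega)) hn
        linarith [hpow s]

lemma exists_pow_div_factorial_eq_coeff (D : ℕ) : ∃ p : Polynomial ℚ, (∀ i, 0 ≤ p.coeff i) ∧
    ∀ n : ℕ, (n : ℚ) ^ D / n.factorial = PowerSeries.coeff n ((p : ℚ⟦X⟧) * exp ℚ) := by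
  induction D with
  | zero => exact ⟨1, fun i => by rw [Polynomial.coeff_one]; split_ifs <;> simp,
    by simp [coeff_exp]⟩
  | succ D ih =>
    obtain ⟨p, hp, h⟩ := ih
    refine ⟨Polynomial.X * (Polynomial.derivative p + p), fun i => ?_, fun n => ?_⟩
    · cases i with
      | zero => simp
      | succ i =>
        rw [Polynomial.coeff_X_mul, Polynomial.coeff_add, Polynomial.coeff_derivative]
        have := hp (i + 1)
        have := hp i
        positivity
    · have h1 : ((Polynomial.X * (Polynomial.derivative p + p) : Polynomial ℚ) : ℚ⟦X⟧) * exp ℚ =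
          PowerSeries.X * d⁄dX ℚ ((p : ℚ⟦X⟧) * exp ℚ) := by
        rw [Derivation.leibniz, derivative_exp, PowerSeries.derivative_coe]
        simp only [Polynomial.coe_mul, Polynomial.coe_add, Polynomial.coe_X, smul_eq_mul]
        ring
      rw [h1]
      cases n with
      | zero => simp
      | succ n =>
        rw [PowerSeries.coeff_succ_X_mul, PowerSeries.coeff_derivative, ← h]
        push_cast
        ring

lemma qSlice_zero_mem_growth : qSlice 0 ∈ growth 1 := by
  refine ⟨natDegree_coeff_qSlice_le 0, fun j => ?_⟩
  obtain ⟨p, hp, h⟩ := exists_pow_div_factorial_eq_coeff (2 * j)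
  have hsmall : ∀ n, n < j → PowerSeries.coeff n (codegreeCoeff j (qSlice 0)) = 0 := by
    intro n hn
    rw [coeff_codegreeCoeff, Polynomial.coeff_reflect, Polynomial.revAt_eq_self_of_lt hn]
    exact Polynomial.coeff_eq_zero_of_natDegree_lt ((natDegree_coeff_qSlice_le 0 n).trans_lt hn)
  refine ⟨p, hp, fun n => ?_⟩
  rw [Nat.cast_one, rescale_one, RingHom.id_apply, ← h]
  rcases lt_or_ge n j with hn | hn
  · rw [hsmall n hn, abs_zero]
    positivity
  · have h1 := coeff_coeff_qSlice_zero_pow_nonneg 1 n (n - j)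
    rw [pow_one] at h1
    rw [coeff_codegreeCoeff_of_le hn, abs_of_nonneg h1, le_div_iff₀ (by positivity), mul_comm]
    exact factorial_mul_coeff_qSlice_zero_le n (n - j) j (by omega)

end BaseSlice

/-- The leading coefficients in the asymptotics of the slices `qSlice k`. -/
noncomputable def leadCoeff (k : ℕ) : ℚ :=
  match k with
  | 0 => 1
  | k + 1 => ((k : ℚ) + 1)⁻¹ * ∑ i : Fin (k + 1),
      ((k - i : ℕ) + 1 : ℚ) * (leadCoeff i * leadCoeff (k - i))
termination_by k
decreasing_by all_goals omega

section Asymptotics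

open PowerSeries

lemma leadCoeff_zero : leadCoeff 0 = 1 := by
  rw [leadCoeff]

lemma leadCoeff_succ (k : ℕ) : ((k : ℚ) + 1) * leadCoeff (k + 1) =
    ∑ p ∈ Finset.HasAntidiagonal.antidiagonal k,
      ((p.2 : ℚ) + 1) * (leadCoeff p.1 * leadCoeff p.2) := by
  rw [leadCoeff, mul_inv_cancel_left₀ (by positivity), Finset.Nat.sum_antidiagonal_eq_sum_range_succ
    (fun a b => ((b : ℚ) + 1) * (leadCoeff a * leadCoeff b)), Finset.sum_range]

lemma leadCoeff_pos (k : ℕ) : 0 < leadCoeff k := by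
  induction k using Nat.strong_induction_on with
  | _ k ih =>
    cases k with
    | zero => rw [leadCoeff_zero]; exact one_pos
    | succ k =>
      refine pos_of_mul_pos_right (a := (k : ℚ) + 1) ?_ (by positivity)
      rw [leadCoeff_succ]
      refine Finset.sum_pos (fun p hp => ?_) ⟨(k, 0), by simp⟩
      have hp := Finset.HasAntidiagonal.mem_antidiagonal.mp hp
      have h1 := ih p.1 (by omega)
      have h2 := ih p.2 (by omega)
      positivity

lemma leadCoeff_sub_half_sum (k : ℕ) :
    leadCoeff (k + 1) - 2⁻¹ * ∑ p ∈ Finset.HasAntidiagonal.antidiagonal k,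
      leadCoeff p.1 * leadCoeff p.2 = leadCoeff (k + 1) / ((k : ℚ) + 2) := by
  have h := leadCoeff_succ k
  have h' := h
  rw [← Finset.Nat.sum_antidiagonal_swap] at h'
  have h2 : ∑ p ∈ Finset.HasAntidiagonal.antidiagonal k,
      (((p.2 : ℚ) + 1) * (leadCoeff p.1 * leadCoeff p.2) +
        ((p.swap.2 : ℚ) + 1) * (leadCoeff p.swap.1 * leadCoeff p.swap.2)) =
      ((k : ℚ) + 2) * ∑ p ∈ Finset.HasAntidiagonal.antidiagonal k,
        leadCoeff p.1 * leadCoeff p.2 := by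
    rw [Finset.mul_sum]
    refine Finset.sum_congr rfl fun p hp => ?_
    rw [← Finset.HasAntidiagonal.mem_antidiagonal.mp hp]
    simp only [Prod.fst_swap, Prod.snd_swap]
    push_cast
    ring
  rw [Finset.sum_add_distrib, ← h, ← h'] at h2
  rw [eq_div_iff (by positivity)]
  linear_combination h2 / 2

lemma growth_of_sub_mem {r : ℕ} {f g : (Polynomial ℚ)⟦X⟧} (h : f - g ∈ growth r)
    (hg : g ∈ growth r) : f ∈ growth r := by
  simpa using add_mem h hg

lemma sum_antidiagonal_smul_mul_mem_growth {k s : ℕ} {f g : ℕ → (Polynomial ℚ)⟦X⟧} (c : ℕ → ℚ)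
    (hfg : ∀ a b, a + b = k → f a * g b ∈ growth s) :
    ∑ p ∈ Finset.HasAntidiagonal.antidiagonal k, c p.2 • (f p.1 * g p.2) ∈ growth s :=
  sum_mem fun p hp => Submodule.smul_mem _ _
    (hfg p.1 p.2 (Finset.HasAntidiagonal.mem_antidiagonal.mp hp))

lemma mem_growth_of_smul_mem {r : ℕ} {c : ℚ} (hc : c ≠ 0) {f : (Polynomial ℚ)⟦X⟧}
    (h : c • f ∈ growth r) : f ∈ growth r :=
  (Submodule.smul_mem_iff _ hc).mp h

lemma tSlice_Qplus_zero_mem : tSlice 0 Qplus ∈ growth 0 := by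
  have h : tSlice 0 Qplus = PowerSeries.X * PowerSeries.C Polynomial.X := by
    ext1 n
    rw [coeff_tSlice, coeff_zero_Qplus, PowerSeries.coeff_mul_C, PowerSeries.coeff_X]
    split_ifs <;> simp
  rw [h]
  exact X_mul_C_X_mem_growth_zero

lemma tSlice_logPleth_mem {k : ℕ} (h : tSlice k Qplus ∈ growth k) :
    tSlice k (logPleth Qplus) ∈ growth k :=
  growth_of_sub_mem (growth_mono (Nat.zero_le k) (tSlice_logPleth_sub_mem k)) h

lemma uSlice_add_two_mem {k r : ℕ} (h : qSlice k ∈ growth r) : uSlice (k + 2) ∈ growth r := by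
  have h1 := sub_mem h (growth_mono (Nat.zero_le r) (qSlice_sub_uSlice_mem k))
  rwa [sub_sub_cancel] at h1

lemma tSlice_succ_sub_qSlice_mem_aux {k : ℕ} (hF : ∀ i ≤ k, tSlice i Qplus ∈ growth i)
    (hG : ∀ i < k, qSlice i ∈ growth (i + 1)) : tSlice (k + 1) Qplus - qSlice k ∈ growth k := by
  have hU : ∀ a ≤ k, uSlice (a + 1) ∈ growth a := by
    intro a ha
    cases a with
    | zero => rw [uSlice_one]; exact X_mul_C_X_mem_growth_zero
    | succ a => exact uSlice_add_two_mem (hG a (by omega))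
  have hL : ∀ b ≤ k,
      tSlice (b + 1) (logPleth fun p => Polynomial.X * Qplus p) ∈ growth b := fun b hb =>
    growth_of_sub_mem (growth_mono (Nat.zero_le b) (tSlice_logPleth_X_mul_sub_mem b)) (hF b hb)
  have h := uSlice_succ (k + 1)
  rw [Finset.Nat.sum_antidiagonal_succ, uSlice_zero, one_mul] at h
  simp only [Nat.cast_succ] at h
  have hsum := sum_antidiagonal_smul_mul_mem_growth (k := k) (s := k)
    (f := fun a => uSlice (a + 1))
    (g := fun b => tSlice (b + 1) (logPleth fun p => Polynomial.X * Qplus p))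
    (fun b => (b : ℚ) + 1) fun a b hab => by
      have := growth_mul_mem (hU a (by omega)) (hL b (by omega))
      rwa [hab] at this
  rw [← sub_eq_iff_eq_add', ← smul_sub] at h
  rw [← h] at hsum
  have h1 := mem_growth_of_smul_mem (by positivity) hsum
  have h2 := growth_mono (Nat.zero_le k) (tSlice_logPleth_X_mul_sub_mem (k + 1))
  have h3 := growth_mono (Nat.zero_le k) (qSlice_sub_uSlice_mem k)
  convert neg_mem (add_mem (add_mem h1 h2) h3) using 1
  abel

lemma tSlice_Qplus_mem_and_qSlice_mem (k : ℕ) :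
    tSlice k Qplus ∈ growth k ∧ qSlice k ∈ growth (k + 1) := by
  induction k using Nat.strong_induction_on with
  | _ k ih =>
    cases k with
    | zero => exact ⟨tSlice_Qplus_zero_mem, qSlice_zero_mem_growth⟩
    | succ k =>
      have hF : tSlice (k + 1) Qplus ∈ growth (k + 1) :=
        growth_of_sub_mem (growth_mono (Nat.le_succ k) (tSlice_succ_sub_qSlice_mem_aux
          (fun i hi => (ih i (by omega)).1) fun i hi => (ih i (by omega)).2)) (ih k (by omega)).2
      refine ⟨hF, mem_growth_of_smul_mem (c := (k : ℚ) + 1) (by positivity) ?_⟩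
      rw [qSlice_succ]
      refine sum_antidiagonal_smul_mul_mem_growth (f := qSlice)
        (g := fun b => tSlice (b + 1) (logPleth Qplus)) (fun b => (b : ℚ) + 1) fun a b hab => ?_
      have hFb : tSlice (b + 1) Qplus ∈ growth (b + 1) := by
        rcases Nat.lt_or_ge b k with hb | hb
        · exact (ih (b + 1) (by omega)).1
        · obtain rfl : b = k := by omega
          exact hF
      have h := growth_mul_mem (ih a (by omega)).2 (tSlice_logPleth_mem hFb)
      rwa [show a + 1 + (b + 1) = k + 1 + 1 by omega] at h

lemma tSlice_logPleth_succ_sub_qSlice_mem (k : ℕ) :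
    tSlice (k + 1) (logPleth Qplus) - qSlice k ∈ growth k := by
  have h1 := growth_mono (Nat.zero_le k) (tSlice_logPleth_sub_mem (k + 1))
  have h2 := tSlice_succ_sub_qSlice_mem_aux (k := k)
    (fun i _ => (tSlice_Qplus_mem_and_qSlice_mem i).1)
    fun i _ => (tSlice_Qplus_mem_and_qSlice_mem i).2
  simpa using add_mem h1 h2

lemma qSlice_zero_pow_mem (r : ℕ) : qSlice 0 ^ r ∈ growth r := by
  induction r with
  | zero => rw [pow_zero]; exact one_mem_growth_zero
  | succ r ih =>
    rw [pow_succ]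
    exact growth_mul_mem ih qSlice_zero_mem_growth

lemma mul_sub_mem_growth {a b : ℕ} {c d : ℚ} {f g : (Polynomial ℚ)⟦X⟧}
    (hf : f - c • qSlice 0 ^ (a + 1) ∈ growth a) (hg : g - d • qSlice 0 ^ (b + 1) ∈ growth b) :
    f * g - (c * d) • qSlice 0 ^ (a + b + 2) ∈ growth (a + b + 1) := by
  have hf' := Submodule.smul_mem (growth (a + 1)) c (qSlice_zero_pow_mem (a + 1))
  have hg' := growth_of_sub_mem (growth_mono (Nat.le_succ b) hg)
    (Submodule.smul_mem (growth (b + 1)) d (qSlice_zero_pow_mem (b + 1)))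
  have h1 := growth_mul_mem hf hg'
  have h2 := growth_mul_mem hf' hg
  rw [Nat.succ_eq_add_one, ← add_assoc] at h1
  rw [show a + 1 + b = a + b + 1 by omega] at h2
  convert add_mem h1 h2 using 1
  have h3 : (c * d) • qSlice 0 ^ (a + b + 2) =
      (c • qSlice 0 ^ (a + 1)) * (d • qSlice 0 ^ (b + 1)) := by
    rw [smul_mul_smul_comm, ← pow_add]
    congr 2
    omega
  rw [h3]
  ring

lemma qSlice_sub_mem (k : ℕ) : qSlice k - leadCoeff k • qSlice 0 ^ (k + 1) ∈ growth k := by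
  induction k using Nat.strong_induction_on with
  | _ k ih =>
    cases k with
    | zero =>
      rw [leadCoeff_zero, one_smul, zero_add, pow_one, sub_self]
      exact zero_mem _
    | succ k =>
      refine mem_growth_of_smul_mem (c := (k : ℚ) + 1) (by positivity) ?_
      rw [smul_sub, qSlice_succ, smul_smul, leadCoeff_succ, Finset.sum_smul,
        ← Finset.sum_sub_distrib]
      refine sum_mem fun p hp => ?_
      have hp := Finset.HasAntidiagonal.mem_antidiagonal.mp hp
      rw [mul_smul, ← smul_sub]
      refine Submodule.smul_mem _ _ ?_
      have h1 : tSlice (p.2 + 1) (logPleth Qplus) - leadCoeff p.2 • qSlice 0 ^ (p.2 + 1) ∈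
          growth p.2 := by
        simpa using add_mem (tSlice_logPleth_succ_sub_qSlice_mem p.2) (ih p.2 (by omega))
      have h := mul_sub_mem_growth (ih p.1 (by omega)) h1
      rwa [hp] at h

lemma uSlice_add_two_sub_mem (k : ℕ) :
    uSlice (k + 2) - leadCoeff k • qSlice 0 ^ (k + 1) ∈ growth k := by
  have h := sub_mem (qSlice_sub_mem k) (growth_mono (Nat.zero_le k) (qSlice_sub_uSlice_mem k))
  convert h using 1
  abel

lemma coeff_Prhs_zero (n : ℕ) : (Prhs n).coeff 0 = (Qfull n).coeff 0 := by
  simp [Prhs]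

lemma coeff_sum_Icc_Qfull_mul (n k : ℕ) :
    (∑ h ∈ Finset.Icc 2 (n - 2), Qfull h * Qfull (n - h)).coeff k =
      PowerSeries.coeff n (∑ p ∈ Finset.HasAntidiagonal.antidiagonal k, uSlice (p.1 + 2) * uSlice
        (p.2 + 2)) := by
  rw [map_sum, Polynomial.finsetSum_coeff]
  simp only [Polynomial.coeff_mul, PowerSeries.coeff_mul, coeff_uSlice_add_two]
  rw [Finset.sum_comm]
  refine Finset.sum_congr rfl fun p _ => ?_
  rw [Finset.Nat.sum_antidiagonal_eq_sum_range_succ (fun a b =>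
    (if 2 ≤ a then (Qfull a).coeff p.1 else 0) * (if 2 ≤ b then (Qfull b).coeff p.2 else 0))]
  refine Finset.sum_subset_zero_on_sdiff (fun h hh => ?_) (fun h hh => ?_) fun h hh => ?_
  · rw [Finset.mem_Icc] at hh
    rw [Finset.mem_range]
    omega
  · simp only [Finset.mem_sdiff, Finset.mem_range, Finset.mem_Icc] at hh
    split_ifs
    · omega
    all_goals simp
  · rw [Finset.mem_Icc] at hh
    rw [if_pos (by omega), if_pos (by omega)]

lemma tSlice_Prhs_zero : tSlice 0 Prhs = qSlice 0 := by
  ext1 n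
  rw [qSlice, coeff_tSlice, coeff_tSlice, coeff_Prhs_zero]

lemma tSlice_Prhs_succ (k : ℕ) : tSlice (k + 1) Prhs = qSlice (k + 1) -
    (2⁻¹ : ℚ) • (∑ p ∈ Finset.HasAntidiagonal.antidiagonal k,
      uSlice (p.1 + 2) * uSlice (p.2 + 2) -
        tSlice k fun n => if 2 ∣ n then tPow 2 (Qfull (n / 2)) else 0) := by
  ext1 n
  rw [map_sub, coeff_rat_smul, map_sub, ← coeff_sum_Icc_Qfull_mul, qSlice]
  simp only [coeff_tSlice]
  rw [Prhs, Polynomial.coeff_sub, mul_assoc, Polynomial.coeff_C_mul, Polynomial.coeff_X_mul,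
    Polynomial.coeff_sub, Polynomial.smul_eq_C_mul]

lemma tSlice_Prhs_sub_mem (k : ℕ) :
    tSlice k Prhs - (leadCoeff k / (k + 1)) • qSlice 0 ^ (k + 1) ∈ growth k := by
  cases k with
  | zero =>
    rw [tSlice_Prhs_zero, leadCoeff_zero, Nat.cast_zero, zero_add, zero_add, div_one, one_smul,
      pow_one, sub_self]
    exact zero_mem _
  | succ k =>
    have hT : tSlice k (fun n => if 2 ∣ n then tPow 2 (Qfull (n / 2)) else 0) ∈ growth (k + 1) := by
      refine growth_mono (Nat.zero_le _) (tSlice_mem_growth_zero (fun n => ?_) k)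
      split_ifs
      · exact (MDegreeLE.Qfull (n / 2)).tPow 2 two_pos
      · exact MDegreeLE.zero _
    have hU : ∑ p ∈ Finset.HasAntidiagonal.antidiagonal k,
        (uSlice (p.1 + 2) * uSlice (p.2 + 2) -
          (leadCoeff p.1 * leadCoeff p.2) • qSlice 0 ^ (k + 2)) ∈ growth (k + 1) := by
      refine sum_mem fun p hp => ?_
      rw [← Finset.HasAntidiagonal.mem_antidiagonal.mp hp]
      exact mul_sub_mem_growth (uSlice_add_two_sub_mem p.1) (uSlice_add_two_sub_mem p.2)
    rw [Finset.sum_sub_distrib, ← Finset.sum_smul] at hU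
    have h := add_mem (sub_mem (qSlice_sub_mem (k + 1)) (Submodule.smul_mem _ (2⁻¹ : ℚ) hU))
      (Submodule.smul_mem _ (2⁻¹ : ℚ) hT)
    have hc := leadCoeff_sub_half_sum k
    rw [tSlice_Prhs_succ, Nat.cast_succ, add_assoc (k : ℚ), one_add_one_eq_two, ← hc]
    convert h using 1
    module

/-- The solution of `(1 + t) f = Σ_n Prhs n x^n`, slice by slice. -/
noncomputable def pSlice (k : ℕ) : (Polynomial ℚ)⟦X⟧ :=
  match k with
  | 0 => tSlice 0 Prhs
  | k + 1 => tSlice (k + 1) Prhs - pSlice k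

lemma pSlice_sub_mem (k : ℕ) :
    pSlice k - (leadCoeff k / (k + 1)) • qSlice 0 ^ (k + 1) ∈ growth k := by
  induction k with
  | zero => exact tSlice_Prhs_sub_mem 0
  | succ k ih =>
    have h1 := growth_of_sub_mem (growth_mono (Nat.le_succ k) ih)
      (Submodule.smul_mem _ _ (qSlice_zero_pow_mem (k + 1)))
    have h := sub_mem (tSlice_Prhs_sub_mem (k + 1)) h1
    convert h using 1
    rw [pSlice]
    abel

lemma coeff_pSlice {n : ℕ} {f : Qmt} (hf : (1 + Polynomial.X) * f = Prhs n) (k : ℕ) :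
    PowerSeries.coeff n (pSlice k) = f.coeff k := by
  induction k with
  | zero =>
    rw [pSlice, coeff_tSlice, ← hf]
    simp [add_mul]
  | succ k ih =>
    rw [pSlice, map_sub, ih, coeff_tSlice, ← hf, add_mul, Polynomial.coeff_add,
      Polynomial.coeff_X_mul, one_mul, add_sub_cancel_right]

end Asymptotics

section Analysis

open PowerSeries Filter Topology

lemma Polynomial.tendsto_eval_mul_pow (p : Polynomial ℝ) {q : ℝ} (hq0 : 0 ≤ q) (hq : q < 1) :
    Tendsto (fun n : ℕ => p.eval (n : ℝ) * q ^ n) atTop (𝓝 0) := by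
  induction p using Polynomial.induction_on' with
  | add f g hf hg =>
    simpa [add_mul] using hf.add hg
  | monomial d a =>
    have h := (tendsto_pow_const_mul_const_pow_of_lt_one d hq0 hq).const_mul a
    simpa [mul_assoc] using h

lemma Polynomial.exists_forall_eval_mul_pow_le (p : Polynomial ℚ) {a b : ℕ} (h : a < b) :
    ∃ N : ℕ, ∀ n : ℕ, N ≤ n → p.eval (n : ℚ) * (a : ℚ) ^ n ≤ (b : ℚ) ^ n := by
  have hb : (0 : ℝ) < b := by exact_mod_cast (Nat.zero_le a).trans_lt h
  have hq : (a : ℝ) / b < 1 := by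
    rw [div_lt_one hb]
    exact_mod_cast h
  have ht := Polynomial.tendsto_eval_mul_pow (p.map (algebraMap ℚ ℝ)) (by positivity) hq
  obtain ⟨N, hN⟩ := eventually_atTop.mp (ht.eventually_le_const one_pos)
  refine ⟨N, fun n hn => ?_⟩
  have h1 := hN n hn
  rw [div_pow, ← mul_div_assoc, div_le_one (by positivity)] at h1
  have h2 : (p.map (algebraMap ℚ ℝ)).eval (n : ℝ) = ((p.eval (n : ℚ) : ℚ) : ℝ) := by
    have := Polynomial.eval_map_algebraMap p (n : ℝ)
    rw [this]
    have := Polynomial.aeval_algebraMap_apply ℝ (n : ℚ) p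
    simpa using this
  rw [h2] at h1
  exact_mod_cast h1

lemma exists_abs_coeff_le_of_mem_expBounded {r : ℕ} (hr : 1 ≤ r) {f : ℚ⟦X⟧}
    (hf : f ∈ expBounded r) : ∃ p : Polynomial ℚ, (∀ n : ℕ, 0 ≤ p.eval (n : ℚ)) ∧
      ∀ n : ℕ, |PowerSeries.coeff n f| ≤ p.eval (n : ℚ) * r ^ n / n.factorial := by
  obtain ⟨p, hp, h⟩ := hf
  refine ⟨p, fun n => ?_, fun n => (h n).trans ?_⟩
  · rw [Polynomial.eval_eq_sum_range]
    exact Finset.sum_nonneg fun i _ => mul_nonneg (hp i) (by positivity)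
  · have hterm : ∀ i ≤ n, p.coeff i * ((r : ℚ) ^ (n - i) * (1 / (n - i).factorial)) ≤
        p.coeff i * n ^ i * (r ^ n / n.factorial) := by
      intro i hi
      rw [mul_assoc]
      refine mul_le_mul_of_nonneg_left ?_ (hp i)
      have h1 : (r : ℚ) ^ (n - i) ≤ r ^ n :=
        pow_le_pow_right₀ (by exact_mod_cast hr) (Nat.sub_le n i)
      have h2 : (n.factorial : ℚ) ≤ (n : ℚ) ^ i * (n - i).factorial := by
        rw [← Nat.factorial_mul_descFactorial hi, mul_comm]
        push_cast
        gcongr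
        exact_mod_cast Nat.descFactorial_le_pow n i
      rw [mul_one_div, ← mul_div_assoc, div_le_div_iff₀ (by positivity) (by positivity)]
      calc (r : ℚ) ^ (n - i) * n.factorial ≤ r ^ n * ((n : ℚ) ^ i * (n - i).factorial) := by gcongr
        _ = (n : ℚ) ^ i * r ^ n * (n - i).factorial := by ring
    rw [PowerSeries.coeff_mul, Finset.Nat.sum_antidiagonal_eq_sum_range_succ (fun a b =>
      PowerSeries.coeff a (p : ℚ⟦X⟧) * PowerSeries.coeff b (rescale (r : ℚ) (exp ℚ)))]
    simp only [Polynomial.coeff_coe, coeff_rescale, coeff_exp, Algebra.algebraMap_self,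
      RingHom.id_apply]
    calc ∑ i ∈ Finset.range (n + 1), p.coeff i * ((r : ℚ) ^ (n - i) * (1 / (n - i).factorial))
        ≤ ∑ i ∈ Finset.range (n + 1), p.coeff i * n ^ i * (r ^ n / n.factorial) :=
          Finset.sum_le_sum fun i hi => hterm i (Nat.lt_succ_iff.mp (Finset.mem_range.mp hi))
      _ ≤ ∑ i ∈ Finset.range (n + 1 + p.natDegree + 1), p.coeff i * n ^ i *
            (r ^ n / n.factorial) := by
          refine Finset.sum_le_sum_of_subset_of_nonneg (fun i hi => ?_) fun i _ _ => ?_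
          · rw [Finset.mem_range] at hi ⊢
            omega
          · have := hp i
            positivity
      _ = p.eval (n : ℚ) * r ^ n / n.factorial := by
          rw [← Finset.sum_mul, Polynomial.eval_eq_sum_range' (n := n + 1 + p.natDegree + 1)
            (by omega), mul_div_assoc]

lemma exists_abs_coeff_le_of_sub_mem {k : ℕ} {c : ℚ} {f : (Polynomial ℚ)⟦X⟧}
    (hf : f - c • qSlice 0 ^ (k + 1) ∈ growth k) (j : ℕ) :
    ∃ p : Polynomial ℚ, (∀ n : ℕ, 0 ≤ p.eval (n : ℚ)) ∧
      ∀ n : ℕ, j ≤ n →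
        |(PowerSeries.coeff n f).coeff (n - j)| ≤ p.eval (n : ℚ) *
          ((k + 1 : ℕ) : ℚ) ^ n / n.factorial := by
  have h : f ∈ growth (k + 1) := growth_of_sub_mem (growth_mono (Nat.le_succ k) hf)
    (Submodule.smul_mem _ _ (qSlice_zero_pow_mem (k + 1)))
  obtain ⟨p, hp0, hp⟩ := exists_abs_coeff_le_of_mem_expBounded (Nat.le_add_left 1 k) (h.2 j)
  refine ⟨p, hp0, fun n hn => ?_⟩
  rw [← coeff_codegreeCoeff_of_le hn]
  exact hp n

lemma exists_le_coeff_of_sub_mem {k : ℕ} (hk : 1 ≤ k) {c : ℚ} (hc : 0 < c)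
    {f : (Polynomial ℚ)⟦X⟧} (hf : f - c • qSlice 0 ^ (k + 1) ∈ growth k) (j : ℕ) :
    ∃ d : ℚ, 0 < d ∧ ∃ N : ℕ, ∀ n : ℕ, N ≤ n →
      d * ((k + 1 : ℕ) : ℚ) ^ n / n.factorial ≤ (PowerSeries.coeff n f).coeff (n - j) := by
  obtain ⟨p, hp0, hp⟩ := exists_abs_coeff_le_of_mem_expBounded hk (hf.2 j)
  set d : ℚ := c / (2 * ((k + 1 : ℕ) : ℚ) ^ j) with hd
  have hd0 : 0 < d := by positivity
  obtain ⟨N, hN⟩ := Polynomial.exists_forall_eval_mul_pow_le (Polynomial.C d⁻¹ * p)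
      (Nat.lt_succ_self k)
  refine ⟨d, hd0, N + j + 1, fun n hn => ?_⟩
  have h1 := hN n (by omega)
  have h2 := pow_div_factorial_le_coeff_codegreeCoeff (k + 1) j n (by omega)
  have h3 := (abs_le.mp (hp n)).1
  rw [map_sub, map_smul, map_sub, map_smul, smul_eq_mul] at h3
  rw [← coeff_codegreeCoeff_of_le (by omega)]
  rw [Polynomial.eval_mul, Polynomial.eval_C, mul_assoc, inv_mul_le_iff₀ hd0] at h1
  have h4 : p.eval (n : ℚ) * (k : ℚ) ^ n / n.factorial ≤
      d * ((k + 1 : ℕ) : ℚ) ^ n / n.factorial := by gcongr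
  have h5 : c * (((k + 1 : ℕ) : ℚ) ^ (n - j) / n.factorial) =
      2 * (d * ((k + 1 : ℕ) : ℚ) ^ n / n.factorial) := by
    have : ((k + 1 : ℕ) : ℚ) ^ n = ((k + 1 : ℕ) : ℚ) ^ (n - j) * ((k + 1 : ℕ) : ℚ) ^ j := by
      rw [← pow_add, Nat.sub_add_cancel (by omega)]
    rw [this, hd]
    field_simp
  have h6 := mul_le_mul_of_nonneg_left h2 hc.le
  linarith

lemma mul_div_choose_le_sq {k N n : ℕ} (hNk : k + 1 ≤ N) (hNn : N ≤ n) {a x y : ℚ}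
    (h : (n : ℚ) ^ (2 * k) * (|x| * |y|) ≤ a ^ 2) :
    (x / (N.choose (k - 1) : ℚ)) * (y / (N.choose (k + 1) : ℚ)) ≤ (a / (N.choose k : ℚ)) ^ 2 := by
  have h1 : (1 : ℚ) ≤ N.choose (k - 1) := by
    exact_mod_cast Nat.choose_pos (by omega)
  have h2 : (1 : ℚ) ≤ N.choose (k + 1) := by
    exact_mod_cast Nat.choose_pos (by omega)
  have h3 : (0 : ℚ) < N.choose k := by
    exact_mod_cast Nat.choose_pos (by omega)
  have h4 : (N.choose k : ℚ) ≤ (n : ℚ) ^ k := by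
    exact_mod_cast (Nat.choose_le_pow N k).trans (Nat.pow_le_pow_left hNn k)
  calc (x / (N.choose (k - 1) : ℚ)) * (y / (N.choose (k + 1) : ℚ))
      ≤ |(x / (N.choose (k - 1) : ℚ)) * (y / (N.choose (k + 1) : ℚ))| := le_abs_self _
    _ = (|x| / N.choose (k - 1)) * (|y| / N.choose (k + 1)) := by
        rw [abs_mul, abs_div, abs_div, Nat.abs_cast, Nat.abs_cast]
    _ ≤ |x| * |y| := mul_le_mul (div_le_self (abs_nonneg x) h1) (div_le_self (abs_nonneg y) h2)
        (by positivity) (abs_nonneg x)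
    _ ≤ (a / (N.choose k : ℚ)) ^ 2 := by
        rw [div_pow, le_div_iff₀ (by positivity)]
        refine le_trans ?_ h
        rw [mul_comm, mul_comm 2 k, pow_mul]
        gcongr

lemma exists_forall_ultraLogConcave {s : ℕ → (Polynomial ℚ)⟦X⟧} {c : ℕ → ℚ} (hc : ∀ k, 0 < c k)
    (hs : ∀ k, s k - c k • qSlice 0 ^ (k + 1) ∈ growth k) (j k M : ℕ) (hk : 1 ≤ k) :
    ∃ N : ℕ, ∀ n : ℕ, N ≤ n →
      ((PowerSeries.coeff n (s (k - 1))).coeff (n - j) / ((n - M).choose (k - 1) : ℚ)) *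
          ((PowerSeries.coeff n (s (k + 1))).coeff (n - j) / ((n - M).choose (k + 1) : ℚ)) ≤
        ((PowerSeries.coeff n (s k)).coeff (n - j) / ((n - M).choose k : ℚ)) ^ 2 := by
  obtain ⟨p, hp0, hp⟩ := exists_abs_coeff_le_of_sub_mem (hs (k - 1)) j
  obtain ⟨q, hq0, hq⟩ := exists_abs_coeff_le_of_sub_mem (hs (k + 1)) j
  obtain ⟨d, hd, N₁, h₁⟩ := exists_le_coeff_of_sub_mem hk (hc k) (hs k) j
  obtain ⟨N₂, h₂⟩ := Polynomial.exists_forall_eval_mul_pow_le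
    (Polynomial.C (d ^ 2)⁻¹ * (Polynomial.X ^ (2 * k) * (p * q)))
    (show k * (k + 2) < (k + 1) * (k + 1) by nlinarith)
  refine ⟨N₁ + N₂ + j + k + M + 1, fun n hn => ?_⟩
  have hlow := h₁ n (by omega)
  have hlow0 : 0 ≤ d * ((k + 1 : ℕ) : ℚ) ^ n / n.factorial := by positivity
  refine mul_div_choose_le_sq (by omega) (Nat.sub_le n M) ?_
  refine le_trans ?_ (pow_le_pow_left₀ hlow0 hlow 2)
  have hx := hp n (by omega)
  have hy := hq n (by omega)
  rw [Nat.sub_add_cancel hk] at hx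
  have h := h₂ n (by omega)
  simp only [Polynomial.eval_mul, Polynomial.eval_C, Polynomial.eval_pow, Polynomial.eval_X] at h
  rw [mul_assoc, inv_mul_le_iff₀ (by positivity)] at h
  have hp0 := hp0 n
  have hq0 := hq0 n
  calc (n : ℚ) ^ (2 * k) * (|(PowerSeries.coeff n (s (k - 1))).coeff (n - j)| *
        |(PowerSeries.coeff n (s (k + 1))).coeff (n - j)|)
      ≤ (n : ℚ) ^ (2 * k) * ((p.eval (n : ℚ) * (k : ℚ) ^ n / n.factorial) *
        (q.eval (n : ℚ) * ((k + 1 + 1 : ℕ) : ℚ) ^ n / n.factorial)) := by gcongr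
    _ = ((n : ℚ) ^ (2 * k) * (p.eval (n : ℚ) * q.eval (n : ℚ)) * ((k * (k + 2) : ℕ) : ℚ) ^ n) /
        (n.factorial : ℚ) ^ 2 := by
        rw [Nat.cast_mul, mul_pow]
        ring
    _ ≤ (d ^ 2 * (((k + 1) * (k + 1) : ℕ) : ℚ) ^ n) / (n.factorial : ℚ) ^ 2 := by gcongr
    _ = (d * ((k + 1 : ℕ) : ℚ) ^ n / n.factorial) ^ 2 := by
        rw [Nat.cast_mul, mul_pow]
        ring

end Analysis

/-- Let `𝒫ₙ` (for `n ≥ 3`) be the unique polynomials satisfying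
`(1+t)·𝒫ₙ = 𝒬ₙ − (t/2)(Σ_{h=2}^{n-2} 𝒬_h 𝒬_{n-h} − 𝒬_{n/2}^{[2]})`.  For fixed `j ≥ 0` and
`k ≥ 1`, for all sufficiently large `n`, the normalized coefficient sequences satisfy the
ultra-log-concavity inequalities
`(𝒫_{n,k}^{n−j}/C(n−3,k))² ≥ (𝒫_{n,k−1}^{n−j}/C(n−3,k−1))·(𝒫_{n,k+1}^{n−j}/C(n−3,k+1))` and
`(𝒬_{n,k}^{n−j}/C(n−2,k))² ≥ (𝒬_{n,k−1}^{n−j}/C(n−2,k−1))·(𝒬_{n,k+1}^{n−j}/C(n−2,k+1))`. -/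
theorem asymptotic_ultra_log_concavity_coeff_t (j k : ℕ) (hk : 1 ≤ k)
    (P : ℕ → Qmt) (hP : ∀ n : ℕ, 3 ≤ n → (1 + Polynomial.X) * P n = Prhs n) :
    ∃ N : ℕ, ∀ n : ℕ, N ≤ n →
      (((P n).coeff k).coeff (n - j) / ((n - 3).choose k : ℚ)) ^ 2 ≥
          (((P n).coeff (k - 1)).coeff (n - j) / ((n - 3).choose (k - 1) : ℚ)) *
            (((P n).coeff (k + 1)).coeff (n - j) / ((n - 3).choose (k + 1) : ℚ)) ∧
      ((Qnk n k).coeff (n - j) / ((n - 2).choose k : ℚ)) ^ 2 ≥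
          ((Qnk n (k - 1)).coeff (n - j) / ((n - 2).choose (k - 1) : ℚ)) *
            ((Qnk n (k + 1)).coeff (n - j) / ((n - 2).choose (k + 1) : ℚ)) := by
  obtain ⟨N₁, h₁⟩ := exists_forall_ultraLogConcave (s := pSlice)
    (fun k => div_pos (leadCoeff_pos k) (by positivity : (0 : ℚ) < k + 1)) pSlice_sub_mem j k 3 hk
  obtain ⟨N₂, h₂⟩ := exists_forall_ultraLogConcave leadCoeff_pos qSlice_sub_mem j k 2 hk
  refine ⟨N₁ + N₂ + 3, fun n hn => ⟨?_, ?_⟩⟩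
  · have h := h₁ n (by omega)
    simp only [coeff_pSlice (hP n (by omega))] at h
    exact h
  · have h := h₂ n (by omega)
    simp only [qSlice, coeff_tSlice] at h
    exact h
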